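/- arXiv:1804.01088 — 8 statements merged into one kernel-verified Lean document; each statement's English description precedes it below -/
import Mathlib

section
/- For any finite simple connected graph G on n ≥ 3 vertices, tr(G) ≤ 2n − 2. -/
open Finset

/-- The triameter of a graph: the maximum of `d(u,v) + d(v,w) + d(u,w)` over all
triples of vertices. -/
noncomputable def SimpleGraph.triameter {V : Type*} [Fintype V] (G : SimpleGraph V) : ℕ :=
  Finset.univ.sup fun p : V × V × V =>
    G.dist p.1 p.2.1 + G.dist p.2.1 p.2.2 + G.dist p.1 p.2.2

namespace SimpleGraph

variable {V : Type*} {G : SimpleGraph V}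

theorem Walk.dist_add_dist_le_length {u v x : V} (p : G.Walk u v) (hx : x ∈ p.support) :
    G.dist u x + G.dist x v ≤ p.length := by
  classical
  rw [← p.take_spec hx, Walk.length_append]
  exact add_le_add (dist_le _) (dist_le _)

theorem Walk.IsPath.card_toFinset_support [DecidableEq V] {u v : V} {p : G.Walk u v}
    (hp : p.IsPath) : #p.support.toFinset = p.length + 1 := by
  rw [List.toFinset_card_of_nodup hp.support_nodup, Walk.length_support]

theorem Connected.dist_add_dist_add_dist_le [Fintype V] (hconn : G.Connected) (u v w : V) :
    G.dist u v + G.dist v w + G.dist u w + 2 ≤ 2 * Fintype.card V := by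
  classical
  obtain ⟨p, hp⟩ := hconn.exists_walk_length_eq_dist u v
  obtain ⟨x, hxp, hmin⟩ := p.support.toFinset.exists_min_image (fun y => G.dist y w)
    ⟨u, by simp⟩
  obtain ⟨q, hq⟩ := hconn.exists_walk_length_eq_dist x w
  have hinter : p.support.toFinset ∩ q.support.toFinset ⊆ {x} := by
    intro y hy
    rw [Finset.mem_inter, List.mem_toFinset (l := q.support)] at hy
    have hle := q.dist_add_dist_le_length hy.2
    have hge := hmin y hy.1
    rw [Finset.mem_singleton, eq_comm, ← hconn.dist_eq_zero_iff]
    lia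
  have hcard := Finset.card_union_add_card_inter p.support.toFinset q.support.toFinset
  rw [(p.isPath_of_length_eq_dist hp).card_toFinset_support,
    (q.isPath_of_length_eq_dist hq).card_toFinset_support] at hcard
  have hone := Finset.card_le_card hinter
  rw [Finset.card_singleton] at hone
  have huniv := Finset.card_le_univ (p.support.toFinset ∪ q.support.toFinset)
  have hsplit := p.dist_add_dist_le_length (List.mem_toFinset.mp hxp)
  have huw := hconn.dist_triangle (u := u) (v := x) (w := w)
  have hvw := hconn.dist_triangle (u := v) (v := x) (w := w)
  rw [G.dist_comm (u := v) (v := x)] at hvw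
  lia

end SimpleGraph

theorem triameter_le_two_card_sub_two {V : Type*} [Fintype V] (G : SimpleGraph V)
    (hconn : G.Connected) (hn : 3 ≤ Fintype.card V) :
    G.triameter ≤ 2 * Fintype.card V - 2 :=
  Finset.sup_le fun p _ =>
    Nat.le_sub_of_add_le (hconn.dist_add_dist_add_dist_le p.1 p.2.1 p.2.2)
end

section
/- Let T be a tree on n ≥ 3 vertices with l ≥ 4 leaves. Then tr(T) ≤ 2n − 2l + 4. -/
open Finset

/-- The number of leaves (vertices of degree 1) of a graph. -/
def SimpleGraph.numLeaves {V : Type*} [Fintype V] [DecidableEq V] (G : SimpleGraph V)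
    [DecidableRel G.Adj] : ℕ :=
  (Finset.univ.filter fun v => G.degree v = 1).card

/-- In a path, every vertex of degree 1 is an endpoint. -/
theorem SimpleGraph.Walk.IsPath.eq_or_eq_of_degree_eq_one {V : Type*} [Fintype V]
    {G : SimpleGraph V} [DecidableRel G.Adj] {u v y : V} {p : G.Walk u v}
    (hp : p.IsPath) (hy : y ∈ p.support) (hdeg : G.degree y = 1) : y = u ∨ y = v := by
  induction p with
  | nil => simp_all
  | @cons a b c h q ih =>
    rw [SimpleGraph.Walk.cons_isPath_iff] at hp
    rw [SimpleGraph.Walk.support_cons, List.mem_cons] at hy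
    rcases hy with rfl | hy
    · exact Or.inl rfl
    rcases ih hp.1 hy with rfl | rfl
    · cases q with
      | nil => exact Or.inr rfl
      | @cons _ d _ h' r =>
        obtain ⟨z, -, hz⟩ := SimpleGraph.degree_eq_one_iff_existsUnique_adj.mp hdeg
        have had : a = d := (hz a h.symm).trans (hz d h').symm
        exact absurd (by simp [had]) hp.2
    · exact Or.inr rfl

/-- Any three vertices of a connected graph are contained in a vertex set whose vertices of degree 1
are among these three, and which has more than half as many vertices as the sum of their
pairwise distances. -/
theorem SimpleGraph.Connected.exists_finset_dist_add_dist_add_dist_le {V : Type*} [Fintype V]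
    [DecidableEq V] {G : SimpleGraph V} [DecidableRel G.Adj] (hG : G.Connected) (u v w : V) :
    ∃ S : Finset V, G.dist u v + G.dist v w + G.dist u w + 2 ≤ 2 * S.card ∧
      ∀ y ∈ S, G.degree y = 1 → y ∈ ({u, v, w} : Finset V) := by
  obtain ⟨p, hp, hpl⟩ := hG.exists_path_of_dist u v
  obtain ⟨x, hx, hmin⟩ := p.support.toFinset.exists_min_image (G.dist w) ⟨u, by simp⟩
  obtain ⟨q, hq, hql⟩ := hG.exists_path_of_dist w x
  rw [List.mem_toFinset] at hx
  refine ⟨p.support.toFinset ∪ q.support.toFinset, ?_, ?_⟩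
  · have hinter : p.support.toFinset ∩ q.support.toFinset ⊆ {x} := by
      intro y hy
      rw [mem_inter, List.mem_toFinset (l := q.support)] at hy
      have hlen := congrArg SimpleGraph.Walk.length (q.take_spec hy.2)
      rw [SimpleGraph.Walk.length_append] at hlen
      have htake := SimpleGraph.dist_le (q.takeUntil y hy.2)
      have hle := hmin y hy.1
      exact mem_singleton.mpr (SimpleGraph.Walk.eq_of_length_eq_zero
        (p := q.dropUntil y hy.2) (by omega))
    have hcard := card_union_add_card_inter p.support.toFinset q.support.toFinset
    rw [List.toFinset_card_of_nodup hp.support_nodup, List.toFinset_card_of_nodup hq.support_nodup,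
      SimpleGraph.Walk.length_support, SimpleGraph.Walk.length_support] at hcard
    have hone := card_le_card hinter
    rw [card_singleton] at hone
    have hlen := congrArg SimpleGraph.Walk.length (p.take_spec hx)
    rw [SimpleGraph.Walk.length_append] at hlen
    have htake := SimpleGraph.dist_le (p.takeUntil x hx)
    have hdrop := SimpleGraph.dist_le (p.dropUntil x hx)
    have huw := hG.dist_triangle (u := u) (v := x) (w := w)
    have hwv := hG.dist_triangle (u := w) (v := x) (w := v)
    rw [G.dist_comm (u := x) (v := w)] at huw
    rw [G.dist_comm (u := w) (v := v)] at hwv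
    omega
  · intro y hy hdeg
    rw [mem_union, List.mem_toFinset, List.mem_toFinset] at hy
    have hpath : y ∈ p.support → y ∈ ({u, v, w} : Finset V) := fun h => by
      rcases hp.eq_or_eq_of_degree_eq_one h hdeg with h | h <;> simp [h]
    rcases hy with hy | hy
    · exact hpath hy
    · rcases hq.eq_or_eq_of_degree_eq_one hy hdeg with h | h
      · simp [h]
      · exact hpath (h ▸ hx)

theorem tree_triameter_le_of_many_leaves {V : Type*} [Fintype V] [DecidableEq V]
    (T : SimpleGraph V) [DecidableRel T.Adj]
    (htree : T.IsTree) (hn : 3 ≤ Fintype.card V) (hl : 4 ≤ T.numLeaves) :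
    T.triameter ≤ 2 * Fintype.card V - 2 * T.numLeaves + 4 := by
  refine Finset.sup_le fun ⟨u, v, w⟩ _ => ?_
  obtain ⟨S, hS, hleaf⟩ := htree.connected.exists_finset_dist_add_dist_add_dist_le u v w
  have hsub : S ⊆ {u, v, w} ∪ univ.filter fun y => ¬ T.degree y = 1 := fun y hy => by
    by_cases h : T.degree y = 1
    · exact mem_union_left _ (hleaf y hy h)
    · exact mem_union_right _ (by simpa using h)
  have hcard := (card_le_card hsub).trans (card_union_le _ _)
  have hthree := card_le_three (a := u) (b := v) (c := w)
  have hsplit := card_filter_add_card_filter_not (s := (univ : Finset V))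
    (fun y => T.degree y = 1)
  rw [card_univ] at hsplit
  unfold SimpleGraph.numLeaves
  dsimp only
  omega
end

section
/- Let T be a tree on n ≥ 3 vertices such that tr(T) = 2n − 4. Then T has exactly 4 leaves. -/
open Finset

namespace SimpleGraph

variable {V : Type*} {G : SimpleGraph V} {a b m u v w x y : V}

/-- The vertices lying on a shortest walk from `a` to `b`. -/
noncomputable def geodesicInterval [Fintype V] (G : SimpleGraph V) (a b : V) : Finset V :=
  Finset.univ.filter fun x => G.dist a x + G.dist x b = G.dist a b

lemma mem_geodesicInterval [Fintype V] :
    x ∈ G.geodesicInterval a b ↔ G.dist a x + G.dist x b = G.dist a b := by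
  simp [geodesicInterval]

lemma IsTree.length_eq_dist_of_isPath (hG : G.IsTree) {p : G.Walk a b} (hp : p.IsPath) :
    p.length = G.dist a b := by
  obtain ⟨q, hq, hql⟩ := hG.connected.exists_path_of_dist a b
  rw [(hG.existsUnique_path a b).unique hp hq, hql]

lemma IsTree.mem_support_iff_dist (hG : G.IsTree) {p : G.Walk a b} (hp : p.IsPath) :
    x ∈ p.support ↔ G.dist a x + G.dist x b = G.dist a b := by
  classical
  constructor
  · intro hx
    rw [← hG.length_eq_dist_of_isPath hp, ← hG.length_eq_dist_of_isPath (hp.takeUntil hx),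
      ← hG.length_eq_dist_of_isPath (hp.dropUntil hx), ← Walk.length_append, p.take_spec hx]
  · intro hx
    obtain ⟨q, -, hq⟩ := hG.connected.exists_path_of_dist a x
    obtain ⟨r, -, hr⟩ := hG.connected.exists_path_of_dist x b
    have hqr : (q.append r).IsPath :=
      Walk.isPath_of_length_eq_dist _ (by rw [Walk.length_append, hq, hr, hx])
    rw [(hG.existsUnique_path a b).unique hp hqr, Walk.mem_support_append_iff]
    exact Or.inl q.end_mem_support

lemma IsTree.card_geodesicInterval [Fintype V] (hG : G.IsTree) (a b : V) :
    (G.geodesicInterval a b).card = G.dist a b + 1 := by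
  classical
  obtain ⟨p, hp, hpl⟩ := hG.connected.exists_path_of_dist a b
  have h : G.geodesicInterval a b = p.support.toFinset := by
    ext x
    rw [mem_geodesicInterval, List.mem_toFinset, hG.mem_support_iff_dist hp]
  rw [h, List.toFinset_card_of_nodup hp.support_nodup, Walk.length_support, hpl]

lemma IsTree.dist_eq_add_of_forall_eq (hG : G.IsTree)
    (h : ∀ x, G.dist a x + G.dist x m = G.dist a m → G.dist m x + G.dist x b = G.dist m b →
      x = m) : G.dist a b = G.dist a m + G.dist m b := by
  obtain ⟨p, hp, hpl⟩ := hG.connected.exists_path_of_dist a m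
  obtain ⟨q, hq, hql⟩ := hG.connected.exists_path_of_dist m b
  have hpq : (p.append q).IsPath := by
    rw [Walk.isPath_def, Walk.support_append, List.nodup_append']
    refine ⟨hp.support_nodup, hq.support_nodup.tail, fun x hx hx' => ?_⟩
    have hxm := h x ((hG.mem_support_iff_dist hp).1 hx)
      ((hG.mem_support_iff_dist hq).1 (List.mem_of_mem_tail hx'))
    have hn := hq.support_nodup
    rw [← Walk.cons_tail_support, List.nodup_cons] at hn
    exact hn.1 (hxm ▸ hx')
  rw [← hG.length_eq_dist_of_isPath hpq, Walk.length_append, hpl, hql]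

/-- The vertex `m` of the path from `u` to `v` closest to `w`. -/
lemma IsTree.exists_gate [Fintype V] (hG : G.IsTree) (u v w : V) :
    ∃ m, G.dist u m + G.dist m v = G.dist u v ∧
      G.dist u w = G.dist u m + G.dist m w ∧ G.dist v w = G.dist v m + G.dist m w ∧
      ∀ x, G.dist u x + G.dist x v = G.dist u v → G.dist m x + G.dist x w = G.dist m w →
        x = m := by
  obtain ⟨m, hm, hmin⟩ := Finset.exists_min_image (G.geodesicInterval u v) (fun x => G.dist x w)
    ⟨u, by simp [mem_geodesicInterval]⟩
  simp only [mem_geodesicInterval] at hm hmin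
  have hgate : ∀ x, G.dist u x + G.dist x v = G.dist u v →
      G.dist m x + G.dist x w = G.dist m w → x = m := by
    intro x hx hxw
    have := hmin x hx
    exact (hG.connected.dist_eq_zero_iff.1 (by omega : G.dist m x = 0)).symm
  refine ⟨m, hm, hG.dist_eq_add_of_forall_eq fun x hx => hgate x ?_,
    hG.dist_eq_add_of_forall_eq fun x hx => hgate x ?_, hgate⟩
  · have h₁ := hG.connected.dist_triangle (u := x) (v := m) (w := v)
    have h₂ := hG.connected.dist_triangle (u := u) (v := x) (w := v)
    omega
  · have h₁ := hG.connected.dist_triangle (u := u) (v := m) (w := x)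
    have h₂ := hG.connected.dist_triangle (u := u) (v := x) (w := v)
    have := G.dist_comm (u := v) (v := x)
    have := G.dist_comm (u := v) (v := m)
    have := G.dist_comm (u := x) (v := m)
    omega

lemma Connected.exists_adj_dist_add_one (hG : G.Connected) (h : x ≠ a) :
    ∃ z, G.Adj x z ∧ G.dist z a + 1 ≤ G.dist x a := by
  obtain ⟨p, hp⟩ := hG.exists_walk_length_eq_dist x a
  cases p with
  | nil => exact absurd rfl h
  | cons hadj q =>
    rw [Walk.length_cons] at hp
    exact ⟨_, hadj, hp ▸ Nat.succ_le_succ (dist_le q)⟩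

lemma Connected.eq_or_eq_of_degree_eq_one (hG : G.Connected) [Fintype (G.neighborSet x)]
    (hx : G.degree x = 1) (h : G.dist a x + G.dist x b = G.dist a b) : x = a ∨ x = b := by
  by_contra! hne
  obtain ⟨z, hz, hza⟩ := hG.exists_adj_dist_add_one hne.1
  obtain ⟨z', hz', hzb⟩ := hG.exists_adj_dist_add_one hne.2
  obtain rfl := (degree_eq_one_iff_existsUnique_adj.1 hx).unique hz hz'
  have := hG.dist_triangle (u := a) (v := z) (w := b)
  have := G.dist_comm (u := a) (v := z)
  have := G.dist_comm (u := a) (v := x)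
  omega

/-- Every vertex `x` lies on the path from `u` to `u` itself or to some leaf. -/
lemma IsTree.exists_degree_eq_one_dist_add [Fintype V] [DecidableRel G.Adj] (hG : G.IsTree)
    (u x : V) : ∃ y, (y = u ∨ G.degree y = 1) ∧ G.dist u x + G.dist x y = G.dist u y := by
  obtain ⟨y, hy, hmax⟩ := Finset.exists_max_image
    (Finset.univ.filter fun y => G.dist u x + G.dist x y = G.dist u y) (G.dist u) ⟨x, by simp⟩
  simp only [Finset.mem_filter, Finset.mem_univ, true_and] at hy hmax
  refine ⟨y, or_iff_not_imp_left.2 fun hyu => ?_, hy⟩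
  obtain ⟨p, hp, -⟩ := hG.connected.exists_path_of_dist u y
  have hpen : ∀ z, G.Adj y z → z = p.penultimate := fun z hz => by
    refine hG.isAcyclic.eq_penultimate_of_adj_end hp hz ((hG.mem_support_iff_dist hp).2 ?_)
    have hzy := dist_eq_one_iff_adj.2 hz.symm
    rcases hG.dist_eq_dist_add_one_of_adj u hz with h | h
    · omega
    · have := hG.connected.dist_triangle (u := x) (v := y) (w := z)
      have := hG.connected.dist_triangle (u := u) (v := x) (w := z)
      have := G.dist_comm (u := y) (v := z)
      have := hmax z (by omega)
      omega
  obtain ⟨z, hz, -⟩ := hG.connected.exists_adj_dist_add_one hyu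
  exact degree_eq_one_iff_existsUnique_adj.2
    ⟨z, hz, fun t ht => (hpen t ht).trans (hpen z hz).symm⟩

/-- A triple spans a subtree that meets the leaves of the tree only in the triple. -/
lemma IsTree.exists_spanned_subtree [Fintype V] [DecidableRel G.Adj] (hG : G.IsTree)
    (u v w : V) : ∃ B : Finset V,
      G.dist u v + G.dist v w + G.dist u w + 2 = 2 * B.card ∧
      ∀ x ∈ B, G.degree x = 1 → x = u ∨ x = v ∨ x = w := by
  classical
  obtain ⟨m, hm, huw, hvw, hgate⟩ := hG.exists_gate u v w
  refine ⟨G.geodesicInterval u v ∪ G.geodesicInterval m w, ?_, fun x hx hdeg => ?_⟩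
  · have hinter : G.geodesicInterval u v ∩ G.geodesicInterval m w = {m} := by
      ext x
      simp only [Finset.mem_inter, mem_geodesicInterval, Finset.mem_singleton]
      exact ⟨fun h => hgate x h.1 h.2, fun h => by subst h; simp [hm]⟩
    have hcard := Finset.card_union_add_card_inter (G.geodesicInterval u v)
      (G.geodesicInterval m w)
    rw [hinter, Finset.card_singleton, hG.card_geodesicInterval,
      hG.card_geodesicInterval] at hcard
    have := G.dist_comm (u := v) (v := m)
    omega
  · rw [Finset.mem_union, mem_geodesicInterval, mem_geodesicInterval] at hx
    rcases hx with hx | hx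
    · rcases hG.connected.eq_or_eq_of_degree_eq_one hdeg hx with h | h <;> simp [h]
    · rcases hG.connected.eq_or_eq_of_degree_eq_one hdeg hx with rfl | h
      · rcases hG.connected.eq_or_eq_of_degree_eq_one hdeg hm with h | h <;> simp [h]
      · simp [h]

lemma IsTree.two_mul_card_le_of_leaves [Fintype V] [DecidableRel G.Adj] (hG : G.IsTree)
    (hleaf : ∀ x, G.degree x = 1 → x = u ∨ x = v ∨ x = w) :
    2 * Fintype.card V ≤ G.dist u v + G.dist v w + G.dist u w + 2 := by
  classical
  obtain ⟨m, hm, huw, hvw, -⟩ := hG.exists_gate u v w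
  have hunion : G.geodesicInterval u v ∪ G.geodesicInterval u w = Finset.univ := by
    refine Finset.eq_univ_of_forall fun x => ?_
    rw [Finset.mem_union, mem_geodesicInterval, mem_geodesicInterval]
    obtain ⟨y, hy, hxy⟩ := hG.exists_degree_eq_one_dist_add u x
    rcases hy.imp_right (hleaf y) with rfl | rfl | rfl | rfl
    · rw [dist_self] at hxy
      obtain rfl := hG.connected.dist_eq_zero_iff.1 (by omega : G.dist x y = 0)
      simp
    · rw [dist_self] at hxy
      obtain rfl := hG.connected.dist_eq_zero_iff.1 (by omega : G.dist x y = 0)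
      simp
    · exact Or.inl hxy
    · exact Or.inr hxy
  have hinter : G.geodesicInterval u m ⊆ G.geodesicInterval u v ∩ G.geodesicInterval u w := by
    intro x hx
    simp only [Finset.mem_inter, mem_geodesicInterval] at hx ⊢
    have := hG.connected.dist_triangle (u := x) (v := m) (w := v)
    have := hG.connected.dist_triangle (u := u) (v := x) (w := v)
    have := hG.connected.dist_triangle (u := x) (v := m) (w := w)
    have := hG.connected.dist_triangle (u := u) (v := x) (w := w)
    omega
  have hle := Finset.card_le_card hinter
  have hcard := Finset.card_union_add_card_inter (G.geodesicInterval u v)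
    (G.geodesicInterval u w)
  rw [hunion, Finset.card_univ] at hcard
  simp only [hG.card_geodesicInterval] at hcard hle
  have := G.dist_comm (u := v) (v := m)
  omega

lemma dist_add_dist_add_dist_le_triameter [Fintype V] (G : SimpleGraph V) (u v w : V) :
    G.dist u v + G.dist v w + G.dist u w ≤ G.triameter :=
  Finset.le_sup (f := fun p : V × V × V =>
    G.dist p.1 p.2.1 + G.dist p.2.1 p.2.2 + G.dist p.1 p.2.2) (Finset.mem_univ (u, v, w))

lemma exists_triameter_eq [Fintype V] [Nonempty V] (G : SimpleGraph V) :
    ∃ u v w, G.triameter = G.dist u v + G.dist v w + G.dist u w := by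
  obtain ⟨⟨u, v, w⟩, -, h⟩ := Finset.exists_mem_eq_sup Finset.univ Finset.univ_nonempty
    fun p : V × V × V => G.dist p.1 p.2.1 + G.dist p.2.1 p.2.2 + G.dist p.1 p.2.2
  exact ⟨u, v, w, h⟩

end SimpleGraph

theorem tree_four_leaves_of_triameter_eq {V : Type*} [Fintype V] [DecidableEq V]
    (T : SimpleGraph V) [DecidableRel T.Adj]
    (htree : T.IsTree) (hn : 3 ≤ Fintype.card V)
    (htr : T.triameter = 2 * Fintype.card V - 4) :
    T.numLeaves = 4 := by
  have : Nonempty V := htree.connected.nonempty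
  apply le_antisymm
  · obtain ⟨u, v, w, huvw⟩ := T.exists_triameter_eq
    obtain ⟨B, hB, hleaf⟩ := htree.exists_spanned_subtree u v w
    have hsub : (univ.filter fun x => T.degree x = 1) ⊆ {u, v, w} ∪ Bᶜ := by
      intro x hx
      by_cases hxB : x ∈ B
      · simpa [hxB] using hleaf x hxB (mem_filter.1 hx).2
      · simp [hxB]
    have hcompl := card_add_card_compl B
    calc T.numLeaves ≤ (({u, v, w} : Finset V) ∪ Bᶜ).card := card_le_card hsub
      _ ≤ ({u, v, w} : Finset V).card + Bᶜ.card := card_union_le _ _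
      _ ≤ 3 + 1 := Nat.add_le_add card_le_three (by omega)
  · by_contra! hlt
    obtain ⟨S, hS, hcard⟩ := exists_superset_card_eq (Nat.le_of_lt_succ hlt) hn
    obtain ⟨u, v, w, -, -, -, rfl⟩ := card_eq_three.1 hcard
    have hle := htree.two_mul_card_le_of_leaves (u := u) (v := v) (w := w)
      fun x hx => by simpa using hS (mem_filter.2 ⟨mem_univ x, hx⟩)
    have := T.dist_add_dist_add_dist_le_triameter u v w
    omega
end

section
/- Let G be a finite simple connected graph on n ≥ 3 vertices and let S be a connected dominating set of G. Then tr(G) ≤ 2|S| + 4; in particular tr(G) ≤ 2γ_c(G) + 4 where γ_c(G) is the connected domination number. -/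
open Finset

/-- The connected domination number: the minimum size of a dominating set that
induces a connected subgraph. -/
noncomputable def SimpleGraph.connectedDominationNumber {V : Type*} [Fintype V]
    (G : SimpleGraph V) : ℕ :=
  sInf {k | ∃ S : Finset V, S.card = k ∧
    (∀ v : V, v ∈ S ∨ ∃ u ∈ S, G.Adj u v) ∧ (G.induce (S : Set V)).Connected}

namespace SimpleGraph

/-- In a connected graph, `d(a,b) + d(b,c) + d(a,c)` is at most `2 (n - 1)`. -/
theorem Connected.dist_add_dist_add_dist_add_two_le {V : Type*} [Fintype V] {G : SimpleGraph V}
    (hG : G.Connected) (a b c : V) :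
    G.dist a b + G.dist b c + G.dist a c + 2 ≤ 2 * Fintype.card V := by
  classical
  obtain ⟨P, hP, hPlen⟩ := hG.exists_path_of_dist a b
  obtain ⟨p, hp, hmin⟩ := P.support.toFinset.exists_min_image (fun x => G.dist x c)
    ⟨a, by simp⟩
  rw [List.mem_toFinset] at hp
  obtain ⟨Q, hQ, hQlen⟩ := hG.exists_path_of_dist p c
  have hap : G.dist a p + G.dist p b ≤ G.dist a b := by
    have h := congrArg Walk.length (P.take_spec hp)
    rw [Walk.length_append] at h
    have := dist_le (P.takeUntil p hp)
    have := dist_le (P.dropUntil p hp)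
    omega
  have hnodup : (p :: Q.support.tail).Nodup := by
    rw [Walk.cons_tail_support]
    exact hQ.support_nodup
  have hdisj : List.Disjoint P.support Q.support.tail := by
    intro q hqP hqQ
    have hq := List.mem_of_mem_tail hqQ
    have h := congrArg Walk.length (Q.take_spec hq)
    rw [Walk.length_append] at h
    have := dist_le (Q.dropUntil q hq)
    have := hmin q (List.mem_toFinset.2 hqP)
    have h0 : (Q.takeUntil q hq).length = 0 := by omega
    exact (List.nodup_cons.1 hnodup).1 (Walk.eq_of_length_eq_zero h0 ▸ hqQ)
  have hcard := (hP.support_nodup.append (List.nodup_cons.1 hnodup).2 hdisj).length_le_card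
  rw [List.length_append, List.length_tail, Walk.length_support, Walk.length_support] at hcard
  have := hG.dist_triangle (u := a) (v := p) (w := c)
  have := hG.dist_triangle (u := b) (v := p) (w := c)
  rw [dist_comm (u := b) (v := p)] at this
  omega

theorem Reachable.dist_map_le {V W : Type*} {G : SimpleGraph V} {H : SimpleGraph W}
    {u v : V} (h : G.Reachable u v) (f : G →g H) : H.dist (f u) (f v) ≤ G.dist u v := by
  obtain ⟨p, hp⟩ := h.exists_walk_length_eq_dist
  rw [← hp, ← p.length_map f]
  exact dist_le _

theorem Connected.triameter_le_of_connected_dominating {V : Type*} [Fintype V]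
    {G : SimpleGraph V} (hG : G.Connected) (S : Finset V)
    (hdom : ∀ v : V, v ∈ S ∨ ∃ u ∈ S, G.Adj u v)
    (hS : (G.induce (S : Set V)).Connected) : G.triameter ≤ 2 * S.card + 4 := by
  have near : ∀ v : V, ∃ x : (S : Set V), G.dist v x ≤ 1 := by
    intro v
    obtain hv | ⟨u, hu, huv⟩ := hdom v
    · exact ⟨⟨v, hv⟩, by simp⟩
    · exact ⟨⟨u, hu⟩, (dist_eq_one_iff_adj.2 huv.symm).le⟩
  choose f hf using near
  have key (u v : V) : G.dist u v ≤ (G.induce (S : Set V)).dist (f u) (f v) + 2 := by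
    have h₁ := hG.dist_triangle (u := u) (v := f u) (w := v)
    have h₂ := hG.dist_triangle (u := (f u : V)) (v := f v) (w := v)
    have h₃ : G.dist (f u : V) (f v) ≤ (G.induce (S : Set V)).dist (f u) (f v) :=
      (hS.preconnected (f u) (f v)).dist_map_le (Embedding.induce _).toHom
    have hu := hf u
    have hv := hf v
    rw [dist_comm] at hv
    omega
  refine Finset.sup_le ?_
  rintro ⟨u, v, w⟩ -
  have h := hS.dist_add_dist_add_dist_add_two_le (f u) (f v) (f w)
  have hc : Fintype.card (S : Set V) = S.card := by simp
  have := key u v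
  have := key v w
  have := key u w
  dsimp only
  omega

end SimpleGraph

theorem triameter_le_two_connected_domination_add_four {V : Type*} [Fintype V]
    (G : SimpleGraph V) (hconn : G.Connected) (hn : 3 ≤ Fintype.card V)
    (S : Finset V) (hdom : ∀ v : V, v ∈ S ∨ ∃ u ∈ S, G.Adj u v)
    (hS : (G.induce (S : Set V)).Connected) :
    G.triameter ≤ 2 * S.card + 4 ∧
      G.triameter ≤ 2 * G.connectedDominationNumber + 4 := by
  refine ⟨hconn.triameter_le_of_connected_dominating S hdom hS, ?_⟩
  have hne : {k | ∃ S : Finset V, S.card = k ∧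
      (∀ v : V, v ∈ S ∨ ∃ u ∈ S, G.Adj u v) ∧ (G.induce (S : Set V)).Connected}.Nonempty :=
    ⟨_, S, rfl, hdom, hS⟩
  obtain ⟨T, hT, hTdom, hTconn⟩ := Nat.sInf_mem hne
  have h := hconn.triameter_le_of_connected_dominating T hTdom hTconn
  rw [hT] at h
  exact h
end

section
/- Let G be a finite simple connected graph on n ≥ 3 vertices and let S be a dominating set of G. Then tr(G) ≤ 6|S|; in particular tr(G) ≤ 6γ(G) where γ(G) is the domination number. -/
open Finset

/-- The domination number: the minimum size of a dominating set. -/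
noncomputable def SimpleGraph.dominationNumber {V : Type*} [Fintype V]
    (G : SimpleGraph V) : ℕ :=
  sInf {k | ∃ S : Finset V, S.card = k ∧ ∀ v : V, v ∈ S ∨ ∃ u ∈ S, G.Adj u v}

namespace SimpleGraph

variable {V : Type*} {G : SimpleGraph V}

/-- In a connected graph on `k` vertices, the distances within a triple of vertices sum to at
most `2 * (k - 1)`. -/
theorem Connected.dist_add_dist_add_dist_add_two_le_two_mul_card [Fintype V] (hG : G.Connected)
    (a b c : V) :
    G.dist a b + G.dist b c + G.dist a c + 2 ≤ 2 * Fintype.card V := by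
  classical
  obtain ⟨P, hP, hPlen⟩ := hG.exists_path_of_dist a b
  obtain ⟨p, hp, hmin⟩ := P.support.toFinset.exists_min_image (fun x => G.dist c x)
    ⟨a, by simp⟩
  obtain ⟨Q, hQ, hQlen⟩ := hG.exists_path_of_dist c p
  have hinter : P.support.toFinset ∩ Q.support.toFinset ⊆ {p} := by
    intro x hx
    rw [mem_inter, List.mem_toFinset, List.mem_toFinset] at hx
    have h₁ := hmin x (List.mem_toFinset.2 hx.1)
    have h₂ := dist_le (Q.takeUntil x hx.2)
    have h₃ := congrArg Walk.length (Q.take_spec hx.2)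
    rw [Walk.length_append] at h₃
    exact mem_singleton.2 (Walk.eq_of_length_eq_zero (p := Q.dropUntil x hx.2) (by omega))
  have hcard := card_union_add_card_inter P.support.toFinset Q.support.toFinset
  rw [List.toFinset_card_of_nodup hP.support_nodup, List.toFinset_card_of_nodup hQ.support_nodup,
    Walk.length_support, Walk.length_support] at hcard
  have hle := card_le_card hinter
  rw [card_singleton] at hle
  have huniv := card_le_univ (P.support.toFinset ∪ Q.support.toFinset)
  rw [List.mem_toFinset] at hp
  have hsplit := congrArg Walk.length (P.take_spec hp)
  rw [Walk.length_append] at hsplit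
  have hap := dist_le (P.takeUntil p hp)
  have hpb := dist_le (P.dropUntil p hp)
  have hac := hG.dist_triangle (u := a) (v := p) (w := c)
  have hbc := hG.dist_triangle (u := b) (v := p) (w := c)
  rw [G.dist_comm (u := b) (v := p)] at hbc
  rw [G.dist_comm (u := p) (v := c)] at hac hbc
  omega

/-- The graph on `S` joining distinct vertices at distance at most three in `G`. -/
def nearGraph (G : SimpleGraph V) (S : Finset V) : SimpleGraph S where
  Adj s t := s ≠ t ∧ G.dist s t ≤ 3
  symm := ⟨fun _ _ h => ⟨h.1.symm, G.dist_comm ▸ h.2⟩⟩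
  loopless := ⟨fun _ h => h.1 rfl⟩

theorem Connected.dist_le_three_mul_length (hG : G.Connected) {S : Finset V} {s t : S}
    (p : (G.nearGraph S).Walk s t) : G.dist s t ≤ 3 * p.length := by
  induction p with
  | nil => simp
  | @cons u v w h p ih =>
    have htri := hG.dist_triangle (u := (u : V)) (v := v) (w := w)
    have hstep : G.dist (u : V) v ≤ 3 := h.2
    rw [Walk.length_cons]
    omega

theorem Connected.exists_dist_le_three_mul_dist_add_two (hG : G.Connected) (S : Finset V)
    (hdom : ∀ v : V, v ∈ S ∨ ∃ u ∈ S, G.Adj u v) :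
    (G.nearGraph S).Connected ∧
      ∃ f : V → S, ∀ u v, G.dist u v ≤ 3 * (G.nearGraph S).dist (f u) (f v) + 2 := by
  have hnear : ∀ v : V, ∃ s : S, G.dist (s : V) v ≤ 1 := by
    intro v
    obtain hv | ⟨u, hu, huv⟩ := hdom v
    · exact ⟨⟨v, hv⟩, by simp⟩
    · exact ⟨⟨u, hu⟩, (dist_eq_one_iff_adj.2 huv).le⟩
  choose f hf using hnear
  have hself : ∀ s : S, (G.nearGraph S).Reachable s (f s) := by
    intro s
    by_cases h : s = f s
    · exact h ▸ Reachable.refl _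
    · refine Adj.reachable ⟨h, ?_⟩
      have := hf s
      rw [G.dist_comm] at this
      omega
  have hwalk : ∀ {u v : V}, G.Walk u v → (G.nearGraph S).Reachable (f u) (f v) := by
    intro u v p
    induction p with
    | nil => exact Reachable.refl _
    | @cons u v w h p ih =>
      refine Reachable.trans ?_ ih
      by_cases heq : f u = f v
      · exact heq ▸ Reachable.refl _
      · refine Adj.reachable ⟨heq, ?_⟩
        have h₁ := hG.dist_triangle (u := (f u : V)) (v := u) (w := f v)
        have h₂ := hG.dist_triangle (u := u) (v := v) (w := f v)
        have h₃ := hf v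
        rw [G.dist_comm] at h₃
        have h₄ := hf u
        have h₅ := dist_eq_one_iff_adj.2 h
        omega
  have hconn : (G.nearGraph S).Connected := by
    have : Nonempty S := hG.nonempty.map f
    refine Connected.mk fun s t => ?_
    obtain ⟨p⟩ := hG.preconnected (s : V) t
    exact (hself s).trans ((hwalk p).trans (hself t).symm)
  refine ⟨hconn, f, fun u v => ?_⟩
  obtain ⟨p, hp⟩ := hconn.exists_walk_length_eq_dist (f u) (f v)
  have h₁ := hG.dist_le_three_mul_length p
  have h₂ := hG.dist_triangle (u := u) (v := (f u : V)) (w := v)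
  have h₃ := hG.dist_triangle (u := (f u : V)) (v := f v) (w := v)
  have h₄ := hf u
  rw [G.dist_comm] at h₄
  have h₅ := hf v
  omega

theorem Connected.triameter_le_six_mul_card [Fintype V] (hG : G.Connected) (S : Finset V)
    (hdom : ∀ v : V, v ∈ S ∨ ∃ u ∈ S, G.Adj u v) : G.triameter ≤ 6 * S.card := by
  obtain ⟨hconn, f, hf⟩ := hG.exists_dist_le_three_mul_dist_add_two S hdom
  refine Finset.sup_le ?_
  rintro ⟨u, v, w⟩ -
  have h := hconn.dist_add_dist_add_dist_add_two_le_two_mul_card (f u) (f v) (f w)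
  rw [Fintype.card_coe] at h
  have h₁ := hf u v
  have h₂ := hf v w
  have h₃ := hf u w
  dsimp only
  omega

end SimpleGraph

theorem triameter_le_six_domination {V : Type*} [Fintype V]
    (G : SimpleGraph V) (hconn : G.Connected) (hn : 3 ≤ Fintype.card V)
    (S : Finset V) (hdom : ∀ v : V, v ∈ S ∨ ∃ u ∈ S, G.Adj u v) :
    G.triameter ≤ 6 * S.card ∧ G.triameter ≤ 6 * G.dominationNumber := by
  refine ⟨hconn.triameter_le_six_mul_card S hdom, ?_⟩
  obtain ⟨T, hT, hTdom⟩ : G.dominationNumber ∈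
      {k | ∃ S : Finset V, S.card = k ∧ ∀ v : V, v ∈ S ∨ ∃ u ∈ S, G.Adj u v} :=
    Nat.sInf_mem ⟨S.card, S, rfl, hdom⟩
  exact hT ▸ hconn.triameter_le_six_mul_card T hTdom
end

section
/- Let G be a finite simple connected graph on n ≥ 3 vertices that is κ-vertex-connected for some κ ≥ 1, i.e., for every set S of vertices with |S| < κ the graph obtained from G by deleting the vertices of S is connected and nonempty. Then tr(G) ≤ 3(n−2)/κ + 3. -/
open Finset

/-- A distance sphere strictly between two vertices separates them, so it is at least as large as
the connectivity. -/
theorem SimpleGraph.Connected.le_card_sphere {V : Type*} [Fintype V]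
    {G : SimpleGraph V} (hconn : G.Connected) {κ : ℕ}
    (hkconn : ∀ S : Finset V, S.card < κ → (G.induce ((S : Set V)ᶜ)).Connected)
    {u v : V} {i : ℕ} (hi : 0 < i) (hiv : i < G.dist u v) :
    κ ≤ #{x | G.dist u x = i} := by
  by_contra! hlt
  have hu : u ∈ ((({x | G.dist u x = i} : Finset V) : Set V)ᶜ) := by
    simp [hi.ne]
  have hv : v ∈ ((({x | G.dist u x = i} : Finset V) : Set V)ᶜ) := by
    simp [hiv.ne']
  obtain ⟨p⟩ := (hkconn _ hlt).preconnected ⟨u, hu⟩ ⟨v, hv⟩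
  have key : ∀ {a b : ((({x | G.dist u x = i} : Finset V) : Set V)ᶜ : Set V)},
      (G.induce _).Walk a b → G.dist u a < i → G.dist u b < i := by
    intro a b p
    induction p with
    | nil => exact id
    | @cons a c b hadj _ ih =>
      intro ha
      apply ih
      have hc : G.dist u c ≠ i := by simpa using c.2
      have htri := hconn.dist_triangle (u := u) (v := a) (w := c)
      have hac : G.dist a c = 1 := SimpleGraph.dist_eq_one_iff_adj.mpr hadj
      omega
  have := key p (by simpa using hi)
  dsimp only at this
  omega

/-- In a `κ`-vertex-connected graph on `n` vertices, `κ (d(u,v) - 1) ≤ n - 2`. -/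
theorem SimpleGraph.Connected.mul_dist_le_card {V : Type*} [Fintype V]
    {G : SimpleGraph V} (hconn : G.Connected) (hn : 2 ≤ Fintype.card V) {κ : ℕ}
    (hkconn : ∀ S : Finset V, S.card < κ → (G.induce ((S : Set V)ᶜ)).Connected) (u v : V) :
    κ * G.dist u v + 2 ≤ Fintype.card V + κ := by
  classical
  obtain hd | hd := (G.dist u v).eq_zero_or_pos
  · rw [hd]
    omega
  set A : Finset V := {x | G.dist u x ∈ Finset.Ioo 0 (G.dist u v)} with hA
  have hcard : κ * (G.dist u v - 1) ≤ #A := by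
    rw [Finset.card_eq_sum_card_fiberwise (f := G.dist u) (t := Finset.Ioo 0 (G.dist u v))
      (fun x hx => by simpa [hA] using hx)]
    calc κ * (G.dist u v - 1) = #(Finset.Ioo 0 (G.dist u v)) • κ := by
          simp [mul_comm]
      _ ≤ _ := Finset.card_nsmul_le_sum _ _ _ fun i hi => by
          have hi' := Finset.mem_Ioo.mp hi
          refine (hconn.le_card_sphere hkconn hi'.1 hi'.2).trans (Finset.card_le_card ?_)
          intro x hx
          have hx' : G.dist u x = i := by simpa using hx
          simp only [hA, Finset.mem_filter, Finset.mem_univ, hx', hi, and_self]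
  have huv : u ≠ v := by
    rintro rfl
    simp at hd
  have hunion : #(insert u (insert v A)) = #A + 2 := by
    rw [Finset.card_insert_of_notMem (by simp [hA, huv]),
      Finset.card_insert_of_notMem (by simp [hA])]
  have hle := Finset.card_le_univ (insert u (insert v A))
  obtain ⟨d, hd'⟩ := Nat.exists_eq_add_of_lt hd
  rw [hd'] at hcard ⊢
  simp only [zero_add, Nat.add_sub_cancel] at hcard ⊢
  rw [mul_add]
  omega

theorem triameter_le_of_vertex_connectivity {V : Type*} [Fintype V]
    (G : SimpleGraph V) (hconn : G.Connected) (hn : 3 ≤ Fintype.card V)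
    (κ : ℕ) (hκ : 1 ≤ κ)
    (hkconn : ∀ S : Finset V, S.card < κ → (G.induce ((S : Set V)ᶜ)).Connected) :
    (G.triameter : ℝ) ≤ 3 * ((Fintype.card V : ℝ) - 2) / (κ : ℝ) + 3 := by
  have hκ' : (0 : ℝ) < κ := by exact_mod_cast hκ
  have hle : κ * G.triameter + 6 ≤ 3 * Fintype.card V + 3 * κ := by
    have := hconn.nonempty
    obtain ⟨⟨u, v, w⟩, -, hp⟩ := Finset.exists_mem_eq_sup Finset.univ Finset.univ_nonempty
      fun p : V × V × V => G.dist p.1 p.2.1 + G.dist p.2.1 p.2.2 + G.dist p.1 p.2.2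
    rw [SimpleGraph.triameter, hp]
    have h := hconn.mul_dist_le_card (by omega) hkconn
    have h₁ := h u v
    have h₂ := h v w
    have h₃ := h u w
    simp only [mul_add]
    omega
  have hle' : (κ : ℝ) * G.triameter + 6 ≤ 3 * Fintype.card V + 3 * κ := by exact_mod_cast hle
  rw [← sub_le_iff_le_add, le_div_iff₀ hκ']
  linarith
end

section
/- Let G be a finite simple connected graph on n ≥ 3 vertices that is neither a complete graph nor a cycle of odd length. Then tr(G) + χ(G) ≤ tr(G) + Δ(G) ≤ 2n + 1, where χ(G) is the chromatic number and Δ(G) is the maximum degree of G. -/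
open Finset

namespace SimpleGraph
variable {V : Type*} {G : SimpleGraph V}

theorem Connected.exists_adj_dist_add_one_eq (hG : G.Connected) {x u : V} (hu : u ≠ x) :
    ∃ p, G.Adj u p ∧ G.dist x p + 1 = G.dist x u := by
  obtain ⟨w, hw⟩ := hG.exists_walk_length_eq_dist u x
  cases w with
  | nil => exact absurd rfl hu
  | @cons _ p _ h w =>
    refine ⟨p, h, ?_⟩
    have h1 := dist_le w
    have h2 := hG.dist_triangle (u := u) (v := p) (w := x)
    rw [dist_eq_one_iff_adj.2 h] at h2
    rw [Walk.length_cons] at hw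
    rw [G.dist_comm (u := x), G.dist_comm (u := x)]
    omega

/-- Ancestor sets of a breadth-first search tree rooted at `x`. -/
theorem Connected.exists_ancestors [Fintype V] [DecidableEq V] [DecidableRel G.Adj]
    (hG : G.Connected) (x : V) :
    ∃ A : V → Finset V, (∀ u, x ∈ A u) ∧ (∀ u, #{w ∈ A u | G.Adj x w} ≤ 1) ∧
      ∀ u v, G.dist u v ≤ #(A u \ A v) + #(A v \ A u) := by
  have hp : ∀ u, ∃ p, G.dist x p = G.dist x u - 1 ∧ (u ≠ x → G.Adj u p) := by
    intro u
    by_cases hu : u = x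
    · exact ⟨x, by simp [hu], fun h => absurd hu h⟩
    · obtain ⟨p, h1, h2⟩ := hG.exists_adj_dist_add_one_eq hu
      exact ⟨p, by omega, fun _ => h1⟩
  choose p hpd hpa using hp
  have hiter : ∀ i u, G.dist x (p^[i] u) = G.dist x u - i := by
    intro i
    induction i with
    | zero => simp
    | succ i ih => intro u; rw [Function.iterate_succ_apply', hpd, ih]; omega
  have hpos : ∀ u, u ≠ x → 0 < G.dist x u := fun u hu => hG.pos_dist_of_ne hu.symm
  have hzero : ∀ u, G.dist x u = 0 → u = x := fun u h => (hG.dist_eq_zero_iff.1 h).symm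
  let A : V → Finset V := fun u => {w | ∃ i ≤ G.dist x u, p^[i] u = w}
  have hAlt : ∀ u w, w ∈ A u → w = u ∨ G.dist x w < G.dist x u := by
    intro u w hw
    obtain ⟨i, hi, rfl⟩ : ∃ i ≤ G.dist x u, p^[i] u = w := by simpa [A] using hw
    rcases i with - | i
    · exact Or.inl rfl
    · right; rw [hiter]; omega
  have hAins : ∀ u, u ≠ x → A u = insert u (A (p u)) := by
    intro u hu
    have := hpos u hu
    ext w
    simp only [A, Finset.mem_filter, Finset.mem_univ, true_and, Finset.mem_insert, hpd]
    constructor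
    · rintro ⟨i, hi, rfl⟩
      rcases i with - | i
      · exact Or.inl rfl
      · exact Or.inr ⟨i, by omega, rfl⟩
    · rintro (rfl | ⟨i, hi, rfl⟩)
      · exact ⟨0, by omega, rfl⟩
      · exact ⟨i + 1, by omega, rfl⟩
  refine ⟨A, ?_, ?_, ?_⟩
  · intro u
    simp only [A, Finset.mem_filter, Finset.mem_univ, true_and]
    exact ⟨G.dist x u, le_rfl, hzero _ (by rw [hiter]; omega)⟩
  · intro u
    rw [Finset.card_le_one]
    have key : ∀ w ∈ ({w ∈ A u | G.Adj x w} : Finset V), w = p^[G.dist x u - 1] u := by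
      intro w hw
      obtain ⟨⟨i, hi, rfl⟩, hadj⟩ : (∃ i ≤ G.dist x u, p^[i] u = w) ∧ G.Adj x w := by
        simpa [A] using hw
      have := dist_eq_one_iff_adj.2 hadj
      rw [hiter] at this
      congr 1
      omega
    intro a ha b hb
    rw [key a ha, key b hb]
  · clear_value A
    have step : ∀ u v, u ≠ v → G.dist x v ≤ G.dist x u →
        G.dist (p u) v ≤ #(A (p u) \ A v) + #(A v \ A (p u)) →
        G.dist u v ≤ #(A u \ A v) + #(A v \ A u) := by
      intro u v huv hle ih
      have hux : u ≠ x := by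
        rintro rfl
        exact huv (hzero v (by simpa using hle)).symm
      have hu1 : u ∉ A v := fun h => by
        rcases hAlt v u h with h | h
        · exact huv h
        · omega
      have hu2 : u ∉ A (p u) := fun h => by
        have h1 := hpos u hux
        have h2 := hpd u
        rcases hAlt (p u) u h with h | h
        · rw [← h] at h2; omega
        · omega
      have e1 : A u \ A v = insert u (A (p u) \ A v) := by
        rw [hAins u hux, Finset.insert_sdiff_of_notMem _ hu1]
      have e2 : A v \ A u = A v \ A (p u) := by
        rw [hAins u hux, Finset.sdiff_insert_of_notMem hu1]
      have htri := hG.dist_triangle (u := u) (v := p u) (w := v)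
      rw [dist_eq_one_iff_adj.2 (hpa u hux)] at htri
      rw [e1, e2, Finset.card_insert_of_notMem (by grind)]
      omega
    have main : ∀ n u v, G.dist x u + G.dist x v = n →
        G.dist u v ≤ #(A u \ A v) + #(A v \ A u) := by
      intro n
      induction n using Nat.strong_induction_on with
      | _ n ih =>
        intro u v hn
        by_cases huv : u = v
        · simp [huv]
        have hd : 0 < G.dist x u ∨ 0 < G.dist x v := by
          by_contra! h
          exact huv ((hzero u (by omega)).trans (hzero v (by omega)).symm)
        rcases le_total (G.dist x v) (G.dist x u) with hle | hle
        · have := hpd u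
          exact step u v huv hle (ih _ (by omega) (p u) v rfl)
        · have := hpd v
          rw [G.dist_comm, Nat.add_comm]
          exact step v u (Ne.symm huv) hle (ih _ (by omega) (p v) u rfl)
    exact fun u v => main _ u v rfl

theorem _root_.Finset.card_sdiff_triple_le {α : Type*} [DecidableEq α] (A B C : Finset α) {x : α}
    (hA : x ∈ A) (hB : x ∈ B) (hC : x ∈ C) :
    (#(A \ B) + #(B \ A)) + (#(B \ C) + #(C \ B)) + (#(A \ C) + #(C \ A)) + 2 ≤
      2 * #(A ∪ B ∪ C) := by
  have hx : #((A ∪ B ∪ C).erase x) + 1 = #(A ∪ B ∪ C) :=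
    Finset.card_erase_add_one (by simp [hA])
  have key : ∀ P Q : Finset α, P ⊆ A ∪ B ∪ C → x ∈ Q →
      #(P \ Q) = ∑ a ∈ (A ∪ B ∪ C).erase x, if a ∈ P ∧ a ∉ Q then 1 else 0 := by
    intro P Q hP hQ
    rw [← Finset.card_filter]
    congr 1
    ext a
    have := @hP a
    simp only [Finset.mem_sdiff, Finset.mem_filter, Finset.mem_erase]
    grind
  rw [key A B (by grind) hB, key B A (by grind) hA, key B C (by grind) hC, key C B (by grind) hB,
    key A C (by grind) hC, key C A (by grind) hA]
  simp only [← Finset.sum_add_distrib]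
  have := Finset.sum_le_card_nsmul ((A ∪ B ∪ C).erase x)
    (fun i => (((if i ∈ A ∧ i ∉ B then 1 else 0) + if i ∈ B ∧ i ∉ A then 1 else 0) +
      ((if i ∈ B ∧ i ∉ C then 1 else 0) + if i ∈ C ∧ i ∉ B then 1 else 0)) +
      ((if i ∈ A ∧ i ∉ C then 1 else 0) + if i ∈ C ∧ i ∉ A then 1 else 0)) 2
    (fun a _ => by by_cases a ∈ A <;> by_cases a ∈ B <;> by_cases a ∈ C <;> simp [*])
  rw [smul_eq_mul] at this
  omega

theorem Connected.dist_triple_add_degree_le [Fintype V] [DecidableRel G.Adj] (hG : G.Connected)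
    (x u v w : V) :
    G.dist u v + G.dist v w + G.dist u w + G.degree x ≤ 2 * Fintype.card V + 1 := by
  classical
  obtain ⟨A, hx, hone, hdist⟩ := hG.exists_ancestors x
  have h1 := Finset.card_sdiff_triple_le (A u) (A v) (A w) (hx u) (hx v) (hx w)
  have h2 := hdist u v
  have h3 := hdist v w
  have h4 := hdist u w
  have h5 : #(A u ∪ A v ∪ A w) ≤ Fintype.card V := Finset.card_le_univ _
  have h6 : G.degree x + #(A u ∪ A v ∪ A w) ≤ Fintype.card V + 3 := by
    have e : #(G.neighborFinset x ∩ (A u ∪ A v ∪ A w)) ≤ 3 := by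
      calc _ ≤ #({a ∈ A u | G.Adj x a} ∪ {a ∈ A v | G.Adj x a} ∪ {a ∈ A w | G.Adj x a}) := by
            apply Finset.card_le_card
            intro a; simp; tauto
        _ ≤ 1 + 1 + 1 := (Finset.card_union_le _ _).trans (add_le_add
            ((Finset.card_union_le _ _).trans (add_le_add (hone u) (hone v))) (hone w))
    have := Finset.card_union_add_card_inter (G.neighborFinset x) (A u ∪ A v ∪ A w)
    have h7 := Finset.card_le_univ (G.neighborFinset x ∪ (A u ∪ A v ∪ A w))
    rw [card_neighborFinset_eq_degree] at this
    omega
  omega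

theorem Connected.triameter_add_maxDegree_le [Fintype V] [DecidableRel G.Adj]
    (hG : G.Connected) : G.triameter + G.maxDegree ≤ 2 * Fintype.card V + 1 := by
  have := hG.nonempty
  obtain ⟨x, hx⟩ := G.exists_maximal_degree_vertex
  obtain ⟨⟨u, v, w⟩, -, h⟩ := Finset.exists_mem_eq_sup (univ : Finset (V × V × V)) univ_nonempty
    fun p => G.dist p.1 p.2.1 + G.dist p.2.1 p.2.2 + G.dist p.1 p.2.2
  rw [triameter, h, hx]
  exact hG.dist_triple_add_degree_le x u v w

theorem eq_or_eq_of_degree_le_two [G.LocallyFinite] {v a b w : V} (hdeg : G.degree v ≤ 2)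
    (ha : G.Adj v a) (hb : G.Adj v b) (hab : a ≠ b) (hw : G.Adj v w) : w = a ∨ w = b := by
  classical
  have h : ({a, b} : Finset V) = G.neighborFinset v := by
    apply Finset.eq_of_subset_of_card_le
    · intro x; simp; rintro (rfl | rfl) <;> assumption
    · rw [Finset.card_pair hab]; simpa using hdeg
  have : w ∈ ({a, b} : Finset V) := by rw [h]; simpa using hw
  simpa using this

theorem Connected.forall_mem_of_forall_adj (hG : G.Connected) {S : Set V} (hS : S.Nonempty)
    (h : ∀ v ∈ S, ∀ w, G.Adj v w → w ∈ S) (v : V) : v ∈ S := by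
  obtain ⟨s, hs⟩ := hS
  by_contra hv
  obtain ⟨w⟩ := hG.preconnected s v
  obtain ⟨d, -, h1, h2⟩ := w.exists_boundary_dart S hs hv
  exact h2 (h _ h1 _ d.adj)

section Brooks

variable {k : ℕ}

/-- `c` is a proper coloring of the subgraph induced on `T`. -/
def IsProperOn (G : SimpleGraph V) (T : Set V) (c : V → Fin k) : Prop :=
  ∀ u ∈ T, ∀ v ∈ T, G.Adj u v → c u ≠ c v

theorem IsProperOn.exists_insert {T : Set V} {c : V → Fin k} {v : V} (hc : G.IsProperOn T c)
    (hv : v ∉ T) {a : Fin k} (ha : ∀ u ∈ T, G.Adj v u → c u ≠ a) :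
    ∃ c' : V → Fin k, G.IsProperOn (insert v T) c' ∧ Set.EqOn c' c T := by
  classical
  refine ⟨Function.update c v a, ?_, fun u hu => Function.update_of_ne (by grind) _ _⟩
  intro x hx y hy hxy
  have hne := hxy.ne
  rcases hx with rfl | hx <;> rcases hy with rfl | hy
  · exact absurd rfl hne
  · rw [Function.update_self, Function.update_of_ne hne.symm]
    exact (ha y hy hxy).symm
  · rw [Function.update_self, Function.update_of_ne hne]
    exact ha x hx hxy.symm
  · rw [Function.update_of_ne (by grind), Function.update_of_ne (by grind)]
    exact hc x hx y hy hxy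

variable [Fintype V] [DecidableRel G.Adj]

/-- A vertex of degree at most `k` all of whose `k` colors are blocked by neighbors in `T` has
all its neighbors in `T`, with distinct colors. -/
theorem forall_adj_mem_of_forall_color {T : Set V} {c : V → Fin k} {v : V} (hdeg : G.degree v ≤ k)
    (h : ∀ a, ∃ u ∈ T, G.Adj v u ∧ c u = a) :
    (∀ w, G.Adj v w → w ∈ T) ∧ Set.InjOn c {w | G.Adj v w} := by
  classical
  choose f hfT hfadj hfc using h
  have hinj : Function.Injective f := Function.LeftInverse.injective hfc
  have himg : univ.image f = G.neighborFinset v := by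
    apply Finset.eq_of_subset_of_card_le
    · intro x hx
      obtain ⟨a, -, rfl⟩ := Finset.mem_image.1 hx
      simpa using hfadj a
    · rw [Finset.card_image_of_injective _ hinj, card_neighborFinset_eq_degree]
      simpa using hdeg
  have key : ∀ w, G.Adj v w → f (c w) = w := by
    intro w hw
    have : w ∈ univ.image f := by rw [himg]; simpa using hw
    obtain ⟨a, -, rfl⟩ := Finset.mem_image.1 this
    rw [hfc]
  refine ⟨fun w hw => key w hw ▸ hfT _, fun w hw w' hw' h => ?_⟩
  rw [← key w hw, ← key w' hw', h]

theorem IsProperOn.exists_insert_of_adj_notMem {T : Set V} {c : V → Fin k} {v w : V}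
    (hdeg : G.degree v ≤ k) (hc : G.IsProperOn T c) (hv : v ∉ T) (hvw : G.Adj v w) (hw : w ∉ T) :
    ∃ c' : V → Fin k, G.IsProperOn (insert v T) c' ∧ Set.EqOn c' c T := by
  by_contra hcon
  refine hw ((forall_adj_mem_of_forall_color (c := c) hdeg fun a => ?_).1 w hvw)
  by_contra! ha
  exact hcon (hc.exists_insert hv ha)

theorem IsProperOn.exists_insert_of_color_eq {T : Set V} {c : V → Fin k} {v x y : V}
    (hdeg : G.degree v ≤ k) (hc : G.IsProperOn T c) (hv : v ∉ T) (hvx : G.Adj v x)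
    (hvy : G.Adj v y) (hxy : x ≠ y) (hcxy : c x = c y) :
    ∃ c' : V → Fin k, G.IsProperOn (insert v T) c' ∧ Set.EqOn c' c T := by
  by_contra hcon
  refine hxy ((forall_adj_mem_of_forall_color (T := T) (c := c) hdeg fun a => ?_).2 hvx hvy hcxy)
  by_contra! ha
  exact hcon (hc.exists_insert hv ha)

/-- Greedy coloring along a path whose last neighbor stays uncolored. -/
theorem IsProperOn.exists_union_path (hdeg : ∀ v, G.degree v ≤ k) {w : V} (l : List V) :
    ∀ {T : Set V} {c : V → Fin k}, G.IsProperOn T c → (l ++ [w]).IsChain G.Adj →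
    (l ++ [w]).Nodup → (∀ v ∈ l ++ [w], v ∉ T) →
    ∃ c' : V → Fin k, G.IsProperOn (T ∪ {v | v ∈ l}) c' ∧ Set.EqOn c' c T := by
  induction l with
  | nil => intro T c hc _ _ _; exact ⟨c, by simpa using hc, fun _ _ => rfl⟩
  | cons a l ih =>
    intro T c hc hchain hnd hT
    obtain ⟨b, hb, hab, hba⟩ : ∃ b ∈ l ++ [w], G.Adj a b ∧ b ≠ a := by
      cases l with
      | nil => simp_all [List.isChain_cons_cons]; grind
      | cons b l => simp_all [List.isChain_cons_cons]; grind
    obtain ⟨c₁, hc₁, he₁⟩ := hc.exists_insert_of_adj_notMem (hdeg a) (hT a (by simp)) hab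
      (hT b (by simp at hb ⊢; tauto))
    obtain ⟨c₂, hc₂, he₂⟩ := ih hc₁ (List.IsChain.tail hchain) (List.Nodup.of_cons hnd) (by
      intro v hv
      have := hT v (by simp at hv ⊢; tauto)
      have : v ≠ a := by rintro rfl; exact (List.nodup_cons.1 hnd).1 hv
      grind)
    refine ⟨c₂, ?_, fun v hv => (he₂ (Or.inr hv)).trans (he₁ hv)⟩
    convert hc₂ using 1
    ext v; simp; tauto

omit [DecidableRel G.Adj] in
/-- Every path extends at its head to one whose head has all its neighbors on the path. -/
theorem exists_append_forall_adj_mem (l : List V) (hl : l ≠ []) (hchain : l.IsChain G.Adj)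
    (hnd : l.Nodup) :
    ∃ M z l', M ++ l = z :: l' ∧ (M ++ l).IsChain G.Adj ∧ (M ++ l).Nodup ∧
      ∀ a, G.Adj z a → a ∈ M ++ l := by
  induction hm : Fintype.card V - l.length using Nat.strong_induction_on generalizing l with
  | _ m ih =>
    obtain ⟨z, l, rfl⟩ := List.exists_cons_of_ne_nil hl
    by_cases h : ∀ a, G.Adj z a → a ∈ z :: l
    · exact ⟨[], z, l, rfl, hchain, hnd, h⟩
    push Not at h
    obtain ⟨a, ha, hal⟩ := h
    have hnd' : (a :: z :: l).Nodup := List.nodup_cons.2 ⟨hal, hnd⟩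
    have hlen := hnd'.length_le_card
    obtain ⟨M, z', l', h1, h2, h3, h4⟩ := ih _ (by simp at hlen hm ⊢; omega) (a :: z :: l)
      (by simp) (List.isChain_cons_cons.2 ⟨ha.symm, hchain⟩) hnd' rfl
    refine ⟨M ++ [a], z', l', ?_⟩
    rw [show M ++ [a] ++ z :: l = M ++ a :: z :: l by simp]
    exact ⟨h1, h2, h3, h4⟩


omit [Fintype V] [DecidableRel G.Adj] in
theorem isChain_adj_reverse {l : List V} : l.reverse.IsChain G.Adj ↔ l.IsChain G.Adj := by
  rw [List.isChain_reverse]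
  simp only [G.adj_comm]

/-- A path ending in `v₃, v₂, v₁`, with `v₁` and `v₃` nonadjacent, can be colored when `v₂` has a
further neighbor on the path. -/
theorem exists_isProperOn_of_path (hdeg : ∀ v, G.degree v ≤ k) (hk : 0 < k) {M : List V}
    {v₁ v₂ v₃ x : V} (hchain : (M ++ [v₃, v₂, v₁]).IsChain G.Adj)
    (hnd : (M ++ [v₃, v₂, v₁]).Nodup) (h13 : ¬ G.Adj v₁ v₃) (hx : x ∈ M) (hxv : G.Adj v₂ x) :
    ∃ c : V → Fin k, G.IsProperOn {v | v ∈ M ++ [v₃, v₂, v₁]} c := by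
  obtain ⟨A, B, rfl⟩ := List.append_of_mem hx
  have h₀ : G.IsProperOn {v₁, v₃} (fun _ => (⟨0, hk⟩ : Fin k)) := by
    rintro a (rfl | rfl) b (rfl | rfl) hab
    · exact absurd rfl hab.ne
    · exact absurd hab h13
    · exact absurd hab.symm h13
    · exact absurd rfl hab.ne
  have hA : (A ++ [x]).IsChain G.Adj := hchain.prefix ⟨B ++ [v₃, v₂, v₁], by simp⟩
  have hB : (B.reverse ++ [x] ).IsChain G.Adj := by
    have : (x :: B).IsChain G.Adj := hchain.infix ⟨A, [v₃, v₂, v₁], by simp⟩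
    simpa using isChain_adj_reverse.2 this
  have hBx : (B.reverse ++ [x] ++ [v₂]).IsChain G.Adj := by
    rw [List.isChain_append]
    exact ⟨hB, by simp, by simpa using hxv.symm⟩
  have hadj : G.Adj v₂ v₁ ∧ G.Adj v₃ v₂ := by
    have : [v₃, v₂, v₁].IsChain G.Adj := hchain.suffix ⟨_, rfl⟩
    simpa [and_comm] using this
  obtain ⟨c₁, hc₁, he₁⟩ := h₀.exists_union_path hdeg A hA
    (by simp [List.nodup_append] at hnd ⊢; grind) (by simp [List.nodup_append] at hnd ⊢; grind)
  obtain ⟨c₂, hc₂, he₂⟩ := hc₁.exists_union_path hdeg _ hBx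
    (by simp [List.nodup_append] at hnd ⊢; grind) (by simp [List.nodup_append] at hnd ⊢; grind)
  have hcol : ∀ v ∈ ({v₁, v₃} : Set V), c₂ v = ⟨0, hk⟩ := fun v hv =>
    (he₂ (Or.inl hv)).trans (he₁ hv)
  obtain ⟨c₃, hc₃, -⟩ := hc₂.exists_insert_of_color_eq (hdeg v₂) (v := v₂) (x := v₁) (y := v₃)
    (by grind) hadj.1 hadj.2.symm (by grind) (by rw [hcol _ (by simp), hcol _ (by simp)])
  refine ⟨c₃, ?_⟩
  convert hc₃ using 1
  ext v; simp; tauto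

/-- A coloring of the complement of a cycle extends to the cycle if one vertex of the cycle has no
neighbor off the cycle while another one does. -/
theorem IsProperOn.exists_union_cycle (hdeg : ∀ v, G.degree v ≤ k) {T : Set V}
    {c : V → Fin k} (hc : G.IsProperOn T c) {z : V} {C : List V}
    (hchain : (z :: C).IsChain G.Adj) (hnd : (z :: C).Nodup)
    (hlast : ∀ y ∈ (z :: C).getLast?, G.Adj z y)
    (hT : ∀ v ∈ z :: C, v ∉ T) (hz : ∀ a ∈ T, ¬ G.Adj z a)
    (hex : ∃ x ∈ C, ∃ u ∈ T, G.Adj x u) :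
    ∃ c' : V → Fin k, G.IsProperOn (T ∪ {v | v ∈ z :: C}) c' := by
  classical
  obtain ⟨A, y, x, B, hC, hy, u, hu, hxu⟩ : ∃ A y x B, z :: C = A ++ y :: x :: B ∧
      (∀ a ∈ T, ¬ G.Adj y a) ∧ ∃ u ∈ T, G.Adj x u := by
    clear hchain hnd hlast hT
    induction C generalizing z with
    | nil => simp at hex
    | cons b C ih =>
      by_cases hb : ∃ u ∈ T, G.Adj b u
      · exact ⟨[], z, b, C, rfl, hz, hb⟩
      · push Not at hb
        obtain ⟨A, y, x, B, h1, h2⟩ := ih hb (by grind)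
        exact ⟨z :: A, y, x, B, by rw [h1]; rfl, h2⟩
  have hyA : (A ++ [y]).IsChain G.Adj := by
    rw [hC] at hchain
    exact hchain.prefix ⟨x :: B, by simp⟩
  have hxB : (x :: B).IsChain G.Adj := by
    rw [hC] at hchain
    exact hchain.suffix ⟨A ++ [y], by simp⟩
  have hcyc : ((A ++ [y]).reverse ++ (x :: B).reverse).IsChain G.Adj := by
    rw [List.isChain_append]
    refine ⟨isChain_adj_reverse.2 hyA, isChain_adj_reverse.2 hxB, ?_⟩
    intro p hp q hq
    rw [List.getLast?_reverse] at hp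
    rw [List.head?_reverse] at hq
    have hp' : z = p := by
      cases A <;> simp_all
    subst hp'
    refine hlast q ?_
    rw [hC, show A ++ y :: x :: B = (A ++ [y]) ++ (x :: B) by simp, List.getLast?_append, hq]
    rfl
  have hpath : ((A.reverse ++ B.reverse) ++ [x]).IsChain G.Adj := by
    have := hcyc.tail
    simpa using this
  obtain ⟨c₁, hc₁, he₁, hcy⟩ : ∃ c₁ : V → Fin k, G.IsProperOn (insert y T) c₁ ∧
      Set.EqOn c₁ c T ∧ c₁ y = c u := by
    have hyT : y ∉ T := hT y (by simp [hC])
    refine ⟨Function.update c y (c u), ?_, fun v hv => Function.update_of_ne (by grind) _ _,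
      Function.update_self ..⟩
    have hne : ∀ v ∈ T, v ≠ y := by grind
    rintro a (rfl | ha) b (rfl | hb) hab
    · exact absurd rfl hab.ne
    · exact absurd hab (hy b hb)
    · exact absurd hab.symm (hy a ha)
    · rw [Function.update_of_ne (hne a ha), Function.update_of_ne (hne b hb)]
      exact hc a ha b hb hab
  rw [hC] at hnd hT
  obtain ⟨c₂, hc₂, he₂⟩ := hc₁.exists_union_path hdeg _ hpath
    (by simp [List.nodup_append] at hnd ⊢; grind) (by simp [List.nodup_append] at hnd ⊢; grind)
  have hxy : G.Adj x y := by
    rw [hC] at hchain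
    have : [y, x].IsChain G.Adj := hchain.infix ⟨A, B, by simp⟩
    simpa [G.adj_comm] using this
  obtain ⟨c₃, hc₃, -⟩ := hc₂.exists_insert_of_color_eq (hdeg x) (v := x) (x := u) (y := y)
    (by grind) hxu hxy (by grind)
    (by rw [he₂ (Or.inr hu), he₂ (Or.inl rfl), he₁ hu, hcy])
  refine ⟨c₃, ?_⟩
  convert hc₃ using 1
  ext v; simp [hC]; tauto

omit [DecidableRel G.Adj] [Fintype V] in
theorem IsProperOn.union {S T : Set V} {c d : V → Fin k} (hc : G.IsProperOn S c)
    (hd : G.IsProperOn T d) (hST : ∀ u ∈ S, ∀ v ∈ T, ¬ G.Adj u v) :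
    ∃ c' : V → Fin k, G.IsProperOn (S ∪ T) c' := by
  classical
  refine ⟨fun v => if v ∈ S then c v else d v, ?_⟩
  intro u hu v hv huv
  by_cases huS : u ∈ S <;> by_cases hvS : v ∈ S
  · simpa [huS, hvS] using hc u huS v hvS huv
  · exact absurd huv (hST u huS v (hv.resolve_left hvS))
  · exact absurd huv.symm (hST v hvS u (hu.resolve_left huS))
  · simpa [huS, hvS] using hd u (hu.resolve_left huS) v (hv.resolve_left hvS) huv

/-- A list can be split at the last element satisfying `p`. -/
theorem _root_.List.exists_append_of_exists_mem {α : Type*} (p : α → Prop) (l : List α)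
    (h : ∃ a ∈ l, p a) : ∃ A b B, l = A ++ b :: B ∧ p b ∧ ∀ a ∈ B, ¬ p a := by
  induction l with
  | nil => simp at h
  | cons a l ih =>
    by_cases hl : ∃ a ∈ l, p a
    · obtain ⟨A, b, B, rfl, h1, h2⟩ := ih hl
      exact ⟨a :: A, b, B, rfl, h1, h2⟩
    · exact ⟨[], a, l, rfl, by grind, by grind⟩

omit [Fintype V] [DecidableRel G.Adj] in
theorem exists_adj_ne_ne [G.LocallyFinite] (v a b : V) (h : 3 ≤ G.degree v) :
    ∃ x, G.Adj v x ∧ x ≠ a ∧ x ≠ b := by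
  classical
  by_contra! hcon
  have : G.neighborFinset v ⊆ {a, b} := by
    intro x hx
    have := hcon x (by simpa using hx)
    simp; tauto
  have := (Finset.card_le_card this).trans Finset.card_le_two
  rw [card_neighborFinset_eq_degree] at this
  omega

theorem exists_isProperOn_of_cliqueFree (hk : 3 ≤ k) (hdeg : ∀ v, G.degree v ≤ k)
    (hfree : G.CliqueFree (k + 1)) (S : Set V) : ∃ c : V → Fin k, G.IsProperOn S c := by
  classical
  induction S using WellFoundedLT.induction with
  | _ S ih =>
  obtain rfl | ⟨v₂, hv₂⟩ := S.eq_empty_or_nonempty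
  · exact ⟨fun _ => ⟨0, by omega⟩, fun u hu => by simp at hu⟩
  by_cases hlow : ∃ v ∈ S, ∃ w, G.Adj v w ∧ w ∉ S
  · obtain ⟨v, hv, w, hvw, hw⟩ := hlow
    obtain ⟨c, hc⟩ := ih (S \ {v}) (by simpa using hv)
    obtain ⟨c', hc', -⟩ := hc.exists_insert_of_adj_notMem (hdeg v) (by simp) hvw (by simp [hw])
    exact ⟨c', by simpa [Set.insert_eq_of_mem hv] using hc'⟩
  push Not at hlow
  by_cases hlow' : ∃ v ∈ S, G.degree v < k
  · obtain ⟨v, hv, hvk⟩ := hlow'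
    obtain ⟨c, hc⟩ := ih (S \ {v}) (by simpa using hv)
    have hfreecol : ∃ a, ∀ u ∈ S \ {v}, G.Adj v u → c u ≠ a := by
      by_contra! hcon
      have hcard : (univ : Finset (Fin k)) ⊆ (G.neighborFinset v).image c := by
        intro a _
        obtain ⟨u, _, hu, rfl⟩ := hcon a
        exact Finset.mem_image_of_mem _ (by simpa using hu)
      have := (Finset.card_le_card hcard).trans Finset.card_image_le
      simp at this
      omega
    obtain ⟨a, ha⟩ := hfreecol
    obtain ⟨c', hc', -⟩ := hc.exists_insert (by simp) ha
    exact ⟨c', by simpa [Set.insert_eq_of_mem hv] using hc'⟩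
  push Not at hlow'
  obtain ⟨v₁, v₃, h21, h23, hne, h13⟩ : ∃ v₁ v₃, G.Adj v₂ v₁ ∧ G.Adj v₂ v₃ ∧ v₁ ≠ v₃ ∧
      ¬ G.Adj v₁ v₃ := by
    by_contra! hcon
    have hcl : G.IsNClique k (G.neighborFinset v₂) := by
      refine ⟨?_, by simpa using (hdeg v₂).antisymm (hlow' v₂ hv₂)⟩
      intro a ha b hb hab
      exact hcon a b (by simpa using ha) (by simpa using hb) hab
    exact hfree _ (hcl.insert (a := v₂) (by simp))
  obtain ⟨M, z, l', hMl, hchain, hnd, hz⟩ := G.exists_append_forall_adj_mem [v₃, v₂, v₁]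
    (by simp) (by simp [h23.symm, h21]) (by simp [h23.ne', h21.ne, hne.symm])
  have hLS : ∀ v ∈ M ++ [v₃, v₂, v₁], v ∈ S := by
    have key : ∀ l : List V, l.IsChain G.Adj → (∀ v ∈ l.head?, v ∈ S) → ∀ v ∈ l, v ∈ S := by
      intro l
      induction l with
      | nil => simp
      | cons a l ihl =>
        intro hl ha
        cases l with
        | nil => simpa using ha
        | cons b l =>
          rw [List.isChain_cons_cons] at hl
          have haS : a ∈ S := ha a rfl
          have := ihl hl.2 (by simpa using hlow a haS b hl.1)
          grind
    intro v hv
    refine key (M ++ [v₃, v₂, v₁]).reverse (isChain_adj_reverse.2 hchain) ?_ v (by grind)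
    simpa using hlow v₂ hv₂ v₁ h21
  have hzS : z ∈ S := hLS z (by simp [hMl])
  obtain ⟨q, hzq, -, -⟩ := exists_adj_ne_ne z z z (hk.trans (hlow' z hzS))
  obtain ⟨A, b, B, hsplit, hzb, hB⟩ := List.exists_append_of_exists_mem (G.Adj z) l' (by
    refine ⟨q, ?_, hzq⟩
    have := hz q hzq
    rw [hMl] at this
    exact (List.mem_cons.1 this).resolve_left hzq.ne')
  rw [hsplit] at hMl
  -- the cycle through `z` closed up by its last neighbor `b`
  set C := A ++ [b] with hCdef
  have hL : M ++ [v₃, v₂, v₁] = (z :: C) ++ B := by simp [hMl, hCdef]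
  have hCchain : (z :: C).IsChain G.Adj := hchain.prefix ⟨B, hL.symm⟩
  have hCnd : (z :: C).Nodup := by grind
  have hzC : ∀ a, G.Adj z a → a ∈ C := by
    intro a ha
    have h1 := hz a ha
    rw [hL] at h1
    have h2 := ha.ne
    grind
  have hCS : {v | v ∈ z :: C} ⊆ S := fun v hv => hLS v (by rw [hL]; exact List.mem_append_left _ hv)
  have hlt : S \ {v | v ∈ z :: C} < S :=
    Set.ssubset_iff_subset_ne.2 ⟨Set.sdiff_subset, by grind⟩
  obtain ⟨c, hc⟩ := ih _ hlt
  by_cases hout : ∃ x ∈ C, ∃ u ∈ S \ {v | v ∈ z :: C}, G.Adj x u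
  · obtain ⟨c', hc'⟩ := hc.exists_union_cycle hdeg hCchain hCnd
      (by simpa [hCdef, List.getLast?_cons] using hzb) (by grind) (by grind) hout
    exact ⟨c', by rwa [Set.sdiff_union_of_subset hCS] at hc'⟩
  push Not at hout
  by_cases hCeq : {v | v ∈ z :: C} = S
  · have hBnil : B = [] := by
      rw [List.eq_nil_iff_forall_not_mem]
      intro v hv
      have : v ∈ {v | v ∈ z :: C} := hCeq ▸ hLS v (by rw [hL]; exact List.mem_append_right _ hv)
      rw [hL] at hnd
      exact List.disjoint_of_nodup_append hnd this hv
    subst hBnil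
    rw [List.append_nil] at hL
    obtain ⟨x, hx, hx1, hx3⟩ := exists_adj_ne_ne v₂ v₁ v₃ (hk.trans (hlow' v₂ hv₂))
    have hxM : x ∈ M := by
      have : x ∈ {v | v ∈ z :: C} := hCeq ▸ hlow v₂ hv₂ x hx
      have : x ∈ M ++ [v₃, v₂, v₁] := hL ▸ this
      have := hx.ne
      grind
    rw [← hCeq, ← hL]
    exact exists_isProperOn_of_path hdeg (by omega) hchain hnd h13 hxM hx
  · obtain ⟨d, hd⟩ := ih _ (Set.ssubset_iff_subset_ne.2 ⟨hCS, hCeq⟩)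
    obtain ⟨c', hc'⟩ := hd.union hc (by
      intro u hu v hv huv
      rcases List.mem_cons.1 hu with rfl | hu
      · exact hv.2 (List.mem_cons_of_mem _ (hzC v huv))
      · exact hout u hu v hv huv)
    exact ⟨c', by rwa [Set.union_sdiff_cancel hCS] at hc'⟩

end Brooks

section MaxDegreeTwo

/-- In a path, an interior vertex of degree at most two has no further neighbors. -/
theorem eq_of_adj_getElem_of_degree_le_two [G.LocallyFinite] (hdeg : ∀ v, G.degree v ≤ 2)
    {L : List V} (hchain : L.IsChain G.Adj) (hnd : L.Nodup) {i : ℕ} (hi : i + 2 < L.length) {w : V}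
    (hw : G.Adj L[i + 1] w) : w = L[i] ∨ w = L[i + 2] := by
  rw [List.isChain_iff_getElem] at hchain
  refine eq_or_eq_of_degree_le_two (hdeg L[i + 1]) (hchain i (by omega)).symm
    (hchain (i + 1) (by omega)) ?_ hw
  rw [Ne, hnd.getElem_inj_iff]
  omega

theorem Connected.exists_spanning_path_of_degree_le_two [Fintype V] [G.LocallyFinite]
    (hG : G.Connected) (hdeg : ∀ v, G.degree v ≤ 2) :
    ∃ L : List V, L.IsChain G.Adj ∧ L.Nodup ∧ ∀ v, v ∈ L := by
  obtain ⟨v₀⟩ := hG.nonempty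
  obtain ⟨M, z, l', hM, hc, hn, hz⟩ :=
    G.exists_append_forall_adj_mem [v₀] (by simp) (by simp) (by simp)
  rw [hM] at hc hn hz
  obtain ⟨N, y, l, hN, hc', hn', hy⟩ := G.exists_append_forall_adj_mem (z :: l').reverse (by simp)
    (isChain_adj_reverse.2 hc) (List.nodup_reverse.2 hn)
  have hz' : ∀ a, G.Adj z a → a ∈ N ++ (z :: l').reverse := fun a ha =>
    List.mem_append_right _ (List.mem_reverse.2 (hz a ha))
  have hlast : (N ++ (z :: l').reverse).getLast? = some z := by simp
  have hhead : (N ++ (z :: l').reverse).head? = some y := by rw [hN]; rfl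
  generalize N ++ (z :: l').reverse = L at *
  refine ⟨L, hc', hn', hG.forall_mem_of_forall_adj (S := {v | v ∈ L}) ⟨y, by simp [hN]⟩ ?_⟩
  intro v hv w hw
  obtain ⟨i, hi, rfl⟩ := List.getElem_of_mem (show v ∈ L from hv)
  rcases i with - | i
  · have : L[0] = y := by simp [hN]
    exact hy w (this ▸ hw)
  · by_cases hi2 : i + 2 < L.length
    · rcases eq_of_adj_getElem_of_degree_le_two hdeg hc' hn' hi2 hw with rfl | rfl <;>
        exact List.getElem_mem _
    · have : L[i + 1] = z := by
        rw [List.getLast?_eq_getElem?] at hlast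
        have e : L.length - 1 = i + 1 := by omega
        rw [e, List.getElem?_eq_getElem hi] at hlast
        exact Option.some.inj hlast
      exact hz' w (this ▸ hw)

theorem succ_eq_or_of_adj_getElem [G.LocallyFinite] (hdeg : ∀ v, G.degree v ≤ 2)
    {L : List V} (hchain : L.IsChain G.Adj) (hnd : L.Nodup) {i j : ℕ} (hij : i < j)
    (hj : j < L.length) (hw : G.Adj L[i] L[j]) : j = i + 1 ∨ (i = 0 ∧ j + 1 = L.length) := by
  rcases i with - | i
  · by_contra! hcon
    obtain ⟨j, rfl⟩ : ∃ j', j = j' + 1 := ⟨j - 1, by omega⟩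
    have := eq_of_adj_getElem_of_degree_le_two hdeg hchain hnd (i := j) (by omega) hw.symm
    rw [hnd.getElem_inj_iff, hnd.getElem_inj_iff] at this
    omega
  · have := eq_of_adj_getElem_of_degree_le_two hdeg hchain hnd (i := i) (by omega) hw
    rw [hnd.getElem_inj_iff, hnd.getElem_inj_iff] at this
    omega

theorem Connected.colorable_two_or_odd_cycle [Fintype V] [G.LocallyFinite] (hG : G.Connected)
    (hn : 3 ≤ Fintype.card V) (hdeg : ∀ v, G.degree v ≤ 2) :
    G.Colorable 2 ∨ ∃ m : ℕ, 3 ≤ m ∧ Odd m ∧ Nonempty (G ≃g cycleGraph m) := by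
  classical
  obtain ⟨L, hchain, hnd, hall⟩ := hG.exists_spanning_path_of_degree_le_two hdeg
  let e : Fin L.length ≃ V := hnd.getEquivOfForallMemList L hall
  have he : ∀ i : Fin L.length, e i = L[i.1] := fun i => rfl
  have hlen : L.length = Fintype.card V := by
    rw [← Fintype.card_congr e, Fintype.card_fin]
  have hadj : ∀ i j : Fin L.length, i < j → G.Adj (e i) (e j) →
      j.1 = i.1 + 1 ∨ (i.1 = 0 ∧ j.1 + 1 = L.length) := by
    intro i j hij h
    rw [he, he] at h
    exact succ_eq_or_of_adj_getElem hdeg hchain hnd hij j.2 h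
  rw [List.isChain_iff_getElem] at hchain
  by_cases hodd : Odd L.length ∧ G.Adj L[0] L[L.length - 1]
  · right
    refine ⟨L.length, by omega, hodd.1, ⟨RelIso.symm ⟨e, ?_⟩⟩⟩
    have key : ∀ i j : Fin L.length, i < j →
        (G.Adj (e i) (e j) ↔ (cycleGraph L.length).Adj i j) := by
      intro i j hij
      have hij' : i.1 < j.1 := hij
      have hj := j.2
      have h1 : (j - i).val = j.1 - i.1 := Fin.sub_val_of_le hij.le
      have h2 : (i - j).val = L.length - j.1 + i.1 := by
        rw [Fin.val_sub, Nat.mod_eq_of_lt (by omega)]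
      rw [cycleGraph_adj', h1, h2]
      constructor
      · intro h
        have := hadj i j hij h
        omega
      · intro h
        rw [he, he]
        by_cases hs : j.1 = i.1 + 1
        · simp only [hs]
          exact hchain i.1 (by omega)
        · have hi0 : i.1 = 0 := by omega
          have hjl : j.1 = L.length - 1 := by omega
          simp only [hi0, hjl]
          exact hodd.2
    intro i j
    rcases lt_trichotomy i j with h | rfl | h
    · exact key i j h
    · simp
    · have := key j i h
      rwa [G.adj_comm, (cycleGraph L.length).adj_comm] at this
  · left
    have key : ∀ i j : Fin L.length, i < j → G.Adj (e i) (e j) → i.1 % 2 ≠ j.1 % 2 := by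
      intro i j hij h
      rcases hadj i j hij h with h1 | ⟨h1, h2⟩
      · omega
      · have hlast : G.Adj L[0] L[L.length - 1] := by
          rw [he, he] at h
          have hjl : j.1 = L.length - 1 := by omega
          simpa only [h1, hjl] using h
        have : ¬ Odd L.length := fun ho => hodd ⟨ho, hlast⟩
        rw [Nat.not_odd_iff] at this
        omega
    refine ⟨Coloring.mk (fun v => ⟨(e.symm v).1 % 2, Nat.mod_lt _ two_pos⟩) ?_⟩
    intro u v huv heq
    rw [Fin.mk.injEq] at heq
    rcases lt_trichotomy (e.symm u) (e.symm v) with h | h | h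
    · exact key _ _ h (by simpa using huv) heq
    · exact huv.ne (e.symm.injective h)
    · exact key _ _ h (by simpa using huv.symm) heq.symm

end MaxDegreeTwo

theorem Connected.two_le_maxDegree [Fintype V] [DecidableRel G.Adj] (hG : G.Connected)
    (hn : 3 ≤ Fintype.card V) : 2 ≤ G.maxDegree := by
  classical
  by_contra! hlt
  have h1 := hG.card_vert_le_card_edgeSet_add_one
  rw [Nat.card_eq_fintype_card, Nat.card_eq_fintype_card, ← edgeFinset_card] at h1
  have h2 := G.sum_degrees_eq_twice_card_edges
  have h3 : ∑ v, G.degree v ≤ ∑ _v : V, 1 :=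
    Finset.sum_le_sum fun v _ => (G.degree_le_maxDegree v).trans (by omega)
  simp at h3
  omega

/-- A clique with one more vertex than the maximum degree fills a connected graph. -/
theorem Connected.cliqueFree_maxDegree_add_one [Fintype V] [DecidableRel G.Adj]
    (hG : G.Connected) (hnc : ¬ Nonempty (G ≃g (⊤ : SimpleGraph V))) :
    G.CliqueFree (G.maxDegree + 1) := by
  classical
  intro s hs
  have hclosed : ∀ v ∈ (s : Set V), ∀ w, G.Adj v w → w ∈ (s : Set V) := by
    intro v hv w hw
    have hsub : s.erase v ⊆ G.neighborFinset v := by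
      intro x hx
      rw [Finset.mem_erase] at hx
      simpa using hs.isClique hv hx.2 hx.1.symm
    have heq := Finset.eq_of_subset_of_card_le hsub (by
      rw [card_neighborFinset_eq_degree, Finset.card_erase_of_mem hv, hs.card_eq]
      simpa using G.degree_le_maxDegree v)
    have : w ∈ s.erase v := by rw [heq]; simpa using hw
    exact Finset.mem_of_mem_erase this
  have hne : (s : Set V).Nonempty := by
    rw [Finset.coe_nonempty, ← Finset.card_pos, hs.card_eq]
    omega
  have hall := hG.forall_mem_of_forall_adj hne hclosed
  have htop : G = ⊤ := by
    ext u v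
    exact ⟨fun h => h.ne, fun h => hs.isClique (hall u) (hall v) h⟩
  exact hnc ⟨htop ▸ Iso.refl⟩

/-- **Brooks' theorem**. -/
theorem Connected.colorable_maxDegree [Fintype V] [DecidableRel G.Adj] (hG : G.Connected)
    (hn : 3 ≤ Fintype.card V) (hnc : ¬ Nonempty (G ≃g (⊤ : SimpleGraph V)))
    (hodd : ¬ ∃ m : ℕ, 3 ≤ m ∧ Odd m ∧ Nonempty (G ≃g cycleGraph m)) :
    G.Colorable G.maxDegree := by
  rcases (hG.two_le_maxDegree hn).eq_or_lt with h | h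
  · rw [← h]
    exact (hG.colorable_two_or_odd_cycle hn fun v => h ▸ G.degree_le_maxDegree v).resolve_right hodd
  · obtain ⟨c, hc⟩ := exists_isProperOn_of_cliqueFree h G.degree_le_maxDegree
      (hG.cliqueFree_maxDegree_add_one hnc) Set.univ
    exact ⟨Coloring.mk c fun {u v} huv => hc u trivial v trivial huv⟩

end SimpleGraph

theorem triameter_add_chromatic_le {V : Type*} [Fintype V]
    (G : SimpleGraph V) [DecidableRel G.Adj]
    (hconn : G.Connected) (hn : 3 ≤ Fintype.card V)
    (hnotcomplete : ¬ Nonempty (G ≃g (⊤ : SimpleGraph V)))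
    (hnotoddcycle : ¬ ∃ m : ℕ, 3 ≤ m ∧ Odd m ∧
      Nonempty (G ≃g SimpleGraph.cycleGraph m)) :
    (G.triameter : ℕ∞) + G.chromaticNumber ≤ (G.triameter : ℕ∞) + (G.maxDegree : ℕ∞) ∧
      G.triameter + G.maxDegree ≤ 2 * Fintype.card V + 1 := by
  refine ⟨add_le_add_right ?_ _, hconn.triameter_add_maxDegree_le⟩
  exact (hconn.colorable_maxDegree hn hnotcomplete hnotoddcycle).chromaticNumber_le
end

section
/- Let G be a finite simple connected graph on n ≥ 3 vertices that contains at least one cycle. Then g(G) = tr(G) if and only if G is a complete graph or G is a cycle. -/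
open Finset

namespace SimpleGraph

variable {V : Type*} {G : SimpleGraph V}

namespace Walk

variable {u v : V}

lemma exists_length_eq_sub (w : G.Walk u v) {i j : ℕ} (hij : i ≤ j) (hj : j ≤ w.length) :
    ∃ p : G.Walk (w.getVert i) (w.getVert j), p.length = j - i := by
  refine ⟨((w.drop i).take (j - i)).copy rfl ?_, ?_⟩
  · rw [drop_getVert, Nat.add_sub_of_le hij]
  · rw [length_copy, take_length, drop_length]
    lia

lemma dist_getVert_le (w : G.Walk u v) {i j : ℕ} (hij : i ≤ j) (hj : j ≤ w.length) :
    G.dist (w.getVert i) (w.getVert j) ≤ j - i := by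
  obtain ⟨p, hp⟩ := w.exists_length_eq_sub hij hj
  exact hp ▸ dist_le p

lemma IsCycle.exists_isPath_length_eq_sub {w : G.Walk u u} (hw : w.IsCycle) {i j : ℕ}
    (hij : i ≤ j) (hj : j < w.length) :
    ∃ p : G.Walk (w.getVert i) (w.getVert j), p.IsPath ∧ p.length = j - i := by
  refine ⟨((w.take j).drop i).copy ?_ rfl, ?_, ?_⟩
  · rw [take_getVert, min_eq_right hij]
  · rw [isPath_copy]
    exact (hw.isPath_take hj).drop i
  · rw [length_copy, drop_length, take_length]
    lia

lemma IsPath.eq_of_length_add_lt_girth {p q : G.Walk u v} (hp : p.IsPath) (hq : q.IsPath)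
    (h : p.length + q.length < G.girth) : p = q := by
  by_contra hne
  obtain ⟨w, -, -, c, hc, hle⟩ := hp.exists_isCycle_length_le_add_of_ne hq hne
  have := girth_le_length hc
  lia

lemma IsPath.dist_eq_length {p : G.Walk u v} (hp : p.IsPath) (h : 2 * p.length ≤ G.girth) :
    G.dist u v = p.length := by
  refine (dist_le p).antisymm (not_lt.mp fun hlt ↦ ?_)
  obtain ⟨q, hq, hlen⟩ := p.reachable.exists_path_of_dist
  have := hp.eq_of_length_add_lt_girth hq (by lia)
  subst this
  lia

lemma IsCycle.dist_getVert {c : G.Walk u u} (hc : c.IsCycle) {i j : ℕ} (hij : i ≤ j)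
    (hj : j < c.length) (h : 2 * (j - i) ≤ G.girth) :
    G.dist (c.getVert i) (c.getVert j) = j - i := by
  obtain ⟨p, hp, hlen⟩ := hc.exists_isPath_length_eq_sub hij hj
  rw [hp.dist_eq_length (by lia), hlen]

lemma IsCycle.not_adj_getVert {c : G.Walk u u} (hc : c.IsCycle) {i j : ℕ} (hij : i + 2 ≤ j)
    (hj : j < c.length) (h : j - i + 1 < G.girth) :
    ¬ G.Adj (c.getVert i) (c.getVert j) := by
  intro hadj
  obtain ⟨p, hp, hlen⟩ := hc.exists_isPath_length_eq_sub (by lia : i ≤ j) hj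
  have := congrArg Walk.length
    (hp.eq_of_length_add_lt_girth (Path.singleton hadj).isPath (by simpa [Path.singleton, hlen]))
  simp [Path.singleton] at this
  lia

lemma IsCycle.getVert_ne {c : G.Walk u u} (hc : c.IsCycle) {i j : ℕ} (hij : i < j)
    (hj : j < c.length) : c.getVert i ≠ c.getVert j := by
  intro h
  have := hc.getVert_injOn' (by simp only [Set.mem_ofPred_eq]; lia)
    (by simp only [Set.mem_ofPred_eq]; lia) h
  lia

lemma exists_getVert_eq_lt_length {w : G.Walk u u} (hw : 0 < w.length) {x : V}
    (hx : x ∈ w.support) : ∃ i < w.length, w.getVert i = x := by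
  obtain ⟨i, rfl, hi⟩ := mem_support_iff_exists_getVert.mp hx
  obtain h | rfl := hi.lt_or_eq
  · exact ⟨i, h, rfl⟩
  · exact ⟨0, hw, by simp⟩

lemma IsCycle.mem_support_of_ncard_neighborSet_le_two [Finite V] (hconn : G.Connected)
    (hdeg : ∀ v, (G.neighborSet v).ncard ≤ 2) {c : G.Walk u u} (hc : c.IsCycle) (x : V) :
    x ∈ c.support := by
  by_contra hx
  obtain ⟨d, -, hfst, hsnd⟩ := (hconn u x).some.exists_boundary_dart {y | y ∈ c.support}
    c.start_mem_support hx
  have heq : c.toSubgraph.neighborSet d.fst = G.neighborSet d.fst :=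
    Set.eq_of_subset_of_ncard_le (c.toSubgraph.neighborSet_subset _)
      ((hdeg _).trans_eq (hc.ncard_neighborSet_toSubgraph_eq_two hfst).symm)
  have hadj : d.snd ∈ c.toSubgraph.neighborSet d.fst := heq ▸ d.adj
  exact hsnd ((mem_verts_toSubgraph c).mp (c.toSubgraph.edge_vert hadj.symm))

end Walk

lemma cycleGraph_adj_of_lt {n : ℕ} {i j : Fin n} (hij : i < j) :
    (cycleGraph n).Adj i j ↔ j.val = i.val + 1 ∨ i.val = 0 ∧ j.val + 1 = n := by
  rw [cycleGraph_adj', Fin.coe_sub_iff_lt.mpr hij, Fin.sub_val_of_le hij.le]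
  lia

/-- A shortest cycle through all vertices has no chords. -/
lemma Walk.IsCycle.nonempty_iso_cycleGraph {u : V} {c : G.Walk u u} (hc : c.IsCycle)
    (hlen : G.girth = c.length) (hspan : ∀ x, x ∈ c.support) :
    Nonempty (G ≃g cycleGraph c.length) := by
  have h3 := hc.three_le_length
  have hbij : Function.Bijective fun i : Fin c.length ↦ c.getVert i := by
    refine ⟨fun i j h ↦ ?_, fun x ↦ ?_⟩
    · by_contra hne
      obtain hlt | hlt := lt_or_gt_of_ne hne
      · exact hc.getVert_ne hlt j.isLt h
      · exact hc.getVert_ne hlt i.isLt h.symm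
    · obtain ⟨i, hi, rfl⟩ := exists_getVert_eq_lt_length (by lia) (hspan x)
      exact ⟨⟨i, hi⟩, rfl⟩
  have hadj : ∀ i j : Fin c.length, i < j →
      (G.Adj (c.getVert i) (c.getVert j) ↔ (cycleGraph c.length).Adj i j) := by
    intro i j hij
    rw [cycleGraph_adj_of_lt hij]
    have hj := j.isLt
    have hij' : i.val < j.val := hij
    refine ⟨fun h ↦ ?_, ?_⟩
    · by_contra hcon
      exact hc.not_adj_getVert (by lia) hj (by lia) h
    · rintro (h | ⟨h0, hl⟩)
      · exact h ▸ c.adj_getVert_succ i.isLt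
      · have := c.adj_getVert_succ hj
        rw [hl, getVert_length] at this
        rw [h0, getVert_zero]
        exact this.symm
  refine ⟨Iso.symm ⟨Equiv.ofBijective _ hbij, fun {i j} ↦ ?_⟩⟩
  simp only [Equiv.ofBijective_apply]
  obtain h | rfl | h := lt_trichotomy i j
  · exact hadj i j h
  · simp
  · rw [G.adj_comm, (cycleGraph _).adj_comm]
    exact hadj j i h

section Triameter

variable [Fintype V]

lemma le_triameter (u v w : V) : G.dist u v + G.dist v w + G.dist u w ≤ G.triameter :=
  Finset.le_sup (f := fun p : V × V × V ↦
    G.dist p.1 p.2.1 + G.dist p.2.1 p.2.2 + G.dist p.1 p.2.2) (Finset.mem_univ (u, v, w))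

lemma triameter_le_iff {k : ℕ} :
    G.triameter ≤ k ↔ ∀ u v w, G.dist u v + G.dist v w + G.dist u w ≤ k := by
  simp [triameter]

lemma girth_le_triameter (hcyc : ¬ G.IsAcyclic) : G.girth ≤ G.triameter := by
  obtain ⟨u, c, hc, hlen⟩ := exists_girth_eq_length.mpr hcyc
  have h3 := hc.three_le_length
  have h := G.le_triameter (c.getVert 0) (c.getVert (c.length / 2)) (c.getVert (c.length - 1))
  have hlast : G.dist (c.getVert 0) (c.getVert (c.length - 1)) = 1 := by
    rw [dist_eq_one_iff_adj]
    have := c.adj_getVert_succ (by lia : c.length - 1 < c.length)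
    rw [Nat.sub_add_cancel (by lia), Walk.getVert_length] at this
    rw [Walk.getVert_zero]
    exact this.symm
  rw [hc.dist_getVert (by lia) (by lia) (by lia), hc.dist_getVert (by lia) (by lia) (by lia),
    hlast] at h
  lia

lemma triameter_le_length_of_forall_mem_support {u : V} {w : G.Walk u u}
    (hspan : ∀ x, x ∈ w.support) : G.triameter ≤ w.length := by
  have key : ∀ i j k : ℕ, i ≤ j → j ≤ k → k ≤ w.length →
      G.dist (w.getVert i) (w.getVert j) + G.dist (w.getVert j) (w.getVert k) +
        G.dist (w.getVert i) (w.getVert k) ≤ w.length := by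
    intro i j k hij hjk hk
    have h1 := w.dist_getVert_le hij (hjk.trans hk)
    have h2 := w.dist_getVert_le hjk hk
    obtain ⟨p, hp⟩ := w.exists_length_eq_sub (Nat.zero_le i) ((hij.trans hjk).trans hk)
    obtain ⟨q, hq⟩ := w.exists_length_eq_sub hk le_rfl
    have h3 := dist_le ((p.reverse.copy rfl (by simp : w.getVert 0 = w.getVert w.length)).append
      q.reverse)
    simp only [Walk.length_append, Walk.length_copy, Walk.length_reverse, hp, hq] at h3
    lia
  rw [triameter_le_iff]
  intro x y z
  obtain ⟨i, rfl, hi⟩ := Walk.mem_support_iff_exists_getVert.mp (hspan x)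
  obtain ⟨j, rfl, hj⟩ := Walk.mem_support_iff_exists_getVert.mp (hspan y)
  obtain ⟨k, rfl, hk⟩ := Walk.mem_support_iff_exists_getVert.mp (hspan z)
  have hxy := G.dist_comm (u := w.getVert i) (v := w.getVert j)
  have hxz := G.dist_comm (u := w.getVert i) (v := w.getVert k)
  have hyz := G.dist_comm (u := w.getVert j) (v := w.getVert k)
  rcases le_total i j with h1 | h1 <;> rcases le_total j k with h2 | h2 <;>
    rcases le_total i k with h3 | h3
  · have := key i j k h1 h2 hk
    omega
  · have := key i j k h1 h2 hk
    omega
  · have := key i k j h3 h2 hj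
    omega
  · have := key k i j h3 h1 hj
    omega
  · have := key j i k h1 h3 hk
    omega
  · have := key j k i h2 h3 hi
    omega
  · have := key k j i h2 h1 hi
    omega
  · have := key k j i h2 h1 hi
    omega

lemma girth_lt_triameter_of_adj_of_notMem_support (hconn : G.Connected) {u x : V}
    {c : G.Walk u u} (hc : c.IsCycle) (hlen : G.girth = c.length) (h4 : 4 ≤ G.girth)
    (hadj : G.Adj x u) (hx : x ∉ c.support) : G.girth < G.triameter := by
  obtain ⟨h, hh⟩ : ∃ h, G.girth / 2 = h + 1 := ⟨G.girth / 2 - 1, by lia⟩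
  have key : ∀ c' : G.Walk u u, c'.IsCycle → c'.length = c.length → x ∉ c'.support →
      G.dist x (c'.getVert h) = h + 1 := by
    intro c' hc' hl hx'
    have hp : (Walk.cons hadj (c'.take h)).IsPath :=
      (hc'.isPath_take (by lia)).cons fun hmem ↦ hx' ((c'.isSubwalk_take h).support_subset hmem)
    have hpl : (Walk.cons hadj (c'.take h)).length = h + 1 := by
      rw [Walk.length_cons, Walk.take_length]
      lia
    rw [hp.dist_eq_length (by lia), hpl]
  have h1 := key c hc rfl hx
  have h2 := key c.reverse hc.reverse (by simp) (by simpa)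
  rw [Walk.getVert_reverse] at h2
  have h3 : 1 < G.dist (c.getVert h) (c.getVert (c.length - h)) :=
    hconn.one_lt_dist_of_ne_of_not_adj (hc.getVert_ne (by lia) (by lia))
      (hc.not_adj_getVert (by lia) (by lia) (by lia))
  have := G.le_triameter x (c.getVert h) (c.getVert (c.length - h))
  lia

lemma three_lt_triameter_of_not_adj (hconn : G.Connected) (hn : 3 ≤ Fintype.card V) {u v : V}
    (hne : u ≠ v) (hadj : ¬ G.Adj u v) : 3 < G.triameter := by
  classical
  obtain ⟨w, hw⟩ := Finset.exists_mem_notMem_of_card_lt_card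
    (s := {u, v}) (t := Finset.univ) (Finset.card_le_two.trans_lt (by rwa [Finset.card_univ]))
  simp only [Finset.mem_insert, Finset.mem_singleton, not_or] at hw
  have h1 := hconn.one_lt_dist_of_ne_of_not_adj hne hadj
  have h2 := hconn.pos_dist_of_ne (Ne.symm hw.2.2)
  have h3 := hconn.pos_dist_of_ne (Ne.symm hw.2.1)
  have := G.le_triameter u v w
  lia

lemma girth_eq_triameter_of_iso_top (hcyc : ¬ G.IsAcyclic)
    (e : G ≃g (⊤ : SimpleGraph V)) : G.girth = G.triameter := by
  refine (girth_le_triameter hcyc).antisymm (le_trans ?_ (three_le_girth hcyc))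
  have hle : ∀ a b, G.dist a b ≤ 1 := by
    intro a b
    by_cases hab : a = b
    · simp [hab]
    · exact (dist_eq_one_iff_adj.mpr (e.map_adj_iff.mp (by simpa using hab))).le
  rw [triameter_le_iff]
  intro u v w
  linarith [hle u v, hle v w, hle u w]

lemma girth_eq_triameter_of_iso_cycleGraph (hconn : G.Connected) (hcyc : ¬ G.IsAcyclic) {m : ℕ}
    (e : G ≃g cycleGraph m) : G.girth = G.triameter := by
  obtain ⟨u, c, hc, hlen⟩ := exists_girth_eq_length.mpr hcyc
  refine (girth_le_triameter hcyc).antisymm (hlen ▸ triameter_le_length_of_forall_mem_support ?_)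
  refine hc.mem_support_of_ncard_neighborSet_le_two hconn fun v ↦ ?_
  rw [← Set.ncard_image_of_injective _ e.injective]
  have himg : e '' G.neighborSet v ⊆ (cycleGraph m).neighborSet (e v) := by
    rintro _ ⟨w, hw, rfl⟩
    exact e.map_adj_iff.mpr hw
  refine (Set.ncard_le_ncard himg).trans ?_
  match m, e with
  | 0, e => exact (e v).elim0
  | 1, e => simp [cycleGraph_one_eq_bot]
  | n + 2, e =>
    rw [cycleGraph_neighborSet]
    exact (Set.ncard_insert_le _ _).trans_eq (by rw [Set.ncard_singleton])

lemma nonempty_iso_cycleGraph_of_girth_eq_triameter (hconn : G.Connected)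
    (h4 : 4 ≤ G.girth) (h : G.girth = G.triameter) :
    Nonempty (G ≃g cycleGraph G.girth) := by
  classical
  have hcyc : ¬ G.IsAcyclic := fun hac ↦ by simp [hac.girth_eq_zero] at h4
  obtain ⟨u, c, hc, hlen⟩ := exists_girth_eq_length.mpr hcyc
  rw [hlen]
  refine hc.nonempty_iso_cycleGraph hlen fun x ↦ ?_
  by_contra hx
  obtain ⟨d, -, hfst, hsnd⟩ := (hconn u x).some.exists_boundary_dart {y | y ∈ c.support}
    c.start_mem_support hx
  refine h.not_lt (girth_lt_triameter_of_adj_of_notMem_support hconn (hc.rotate hfst) ?_ h4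
    d.adj.symm ?_)
  · simpa using hlen
  · simpa using hsnd

end Triameter

end SimpleGraph

theorem girth_eq_triameter_iff {V : Type*} [Fintype V] (G : SimpleGraph V)
    (hconn : G.Connected) (hn : 3 ≤ Fintype.card V) (hcyc : ¬ G.IsAcyclic) :
    G.girth = G.triameter ↔
      Nonempty (G ≃g (⊤ : SimpleGraph V)) ∨
        ∃ m : ℕ, 3 ≤ m ∧ Nonempty (G ≃g SimpleGraph.cycleGraph m) := by
  have h3 := SimpleGraph.three_le_girth hcyc
  refine ⟨fun h ↦ ?_, ?_⟩
  · obtain h4 | h4 := h3.lt_or_eq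
    · exact .inr ⟨G.girth, h3,
        SimpleGraph.nonempty_iso_cycleGraph_of_girth_eq_triameter hconn h4 h⟩
    · have htop : G = ⊤ := by
        by_contra hne
        obtain ⟨u, v, huv, hadj⟩ := SimpleGraph.ne_top_iff_exists_not_adj.mp hne
        have := SimpleGraph.three_lt_triameter_of_not_adj hconn hn huv hadj
        lia
      exact .inl ⟨htop ▸ SimpleGraph.Iso.refl⟩
  · rintro (⟨⟨e⟩⟩ | ⟨m, -, ⟨e⟩⟩)
    · exact SimpleGraph.girth_eq_triameter_of_iso_top hcyc e
    · exact SimpleGraph.girth_eq_triameter_of_iso_cycleGraph hconn hcyc e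
end
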